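/- arXiv:math/0109093 — 2 statements merged into one kernel-verified Lean document; each statement's English description precedes it below -/
import Mathlib

section
/- Let p, q ≥ 1 and let μ be a partition of k with k ≤ pq. Fix a permutation w_μ ∈ S_k of cycle type μ. Then the normalized irreducible character of S_{pq} indexed by the rectangular partition p×q satisfies χ̂^{p×q}(μ, 1^{pq−k}) = (−1)^k · Σ_{(u,v) ∈ S_k × S_k, uv = w_μ} p^{κ(u)} (−q)^{κ(v)}, where the sum ranges over all k! pairs (u,v) of permutations in S_k whose product is w_μ. -/
open MvPolynomial

/-- The Vandermonde product `∏_{i<j} (x_i - x_j)`. -/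
noncomputable def vandermondeMv (r : ℕ) : MvPolynomial (Fin r) ℤ :=
  ∏ p ∈ Finset.univ.filter (fun p : Fin r × Fin r => p.1 < p.2), (X p.1 - X p.2)

/-- The power sum `x_1^a + ⋯ + x_r^a`. -/
noncomputable def powerSumMv (r : ℕ) (a : ℕ) : MvPolynomial (Fin r) ℤ :=
  ∑ i : Fin r, X i ^ a

/-- Frobenius character formula definition of the irreducible symmetric group character
`χ^λ(μ)`: the coefficient of `x^{λ+δ}` in `(∏_{i<j}(x_i-x_j)) · p_μ`, where `L` lists the
parts of `λ` (weakly decreasing, zeros allowed) and `μ` is the multiset of cycle lengths. -/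
noncomputable def symChar (L : List ℕ) (μ : Multiset ℕ) : ℤ :=
  MvPolynomial.coeff
    (Finsupp.equivFunOnFinite.symm
      (fun i : Fin L.length => L.get i + (L.length - 1 - (i : ℕ))))
    (vandermondeMv L.length * (μ.map (powerSumMv L.length)).prod)

/-- The number of cycles `κ(w)` of a permutation (fixed points included). -/
def cyclesCount {k : ℕ} (w : Equiv.Perm (Fin k)) : ℕ := w.partition.parts.card


set_option linter.unusedSectionVars false

/-- The sum of monomials over colourings fixed by `w`. -/
noncomputable def PW {α : Type} [Fintype α] [DecidableEq α] (r : ℕ) (w : Equiv.Perm α) :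
    MvPolynomial (Fin r) ℤ :=
  ∑ e : α → Fin r, if e ∘ w = e then ∏ j, X (e j) else 0

/-- The number of colourings fixed by `w`. -/
def fixN {α : Type} [Fintype α] [DecidableEq α] (r : ℕ) (w : Equiv.Perm α) : ℤ :=
  ∑ e : α → Fin r, if e ∘ w = e then 1 else 0

/-- The signed convolution. -/
def RR {α : Type} [Fintype α] [DecidableEq α] (p q : ℕ) (w : Equiv.Perm α) : ℤ :=
  ∑ v : Equiv.Perm α, fixN p (w * v⁻¹) * ((Equiv.Perm.sign v : ℤˣ) : ℤ) * fixN q v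

section basic
variable {α : Type} [Fintype α] [DecidableEq α]

theorem PW_conj (r : ℕ) (w π : Equiv.Perm α) : PW r (π * w * π⁻¹) = PW r w := by
  unfold PW
  refine Fintype.sum_equiv (π.arrowCongr (Equiv.refl _)).symm _ _ ?_
  intro e
  have h1 : (e ∘ ⇑(π * w * π⁻¹) = e) ↔ ((e ∘ π) ∘ w = e ∘ π) := by
    constructor
    · intro h
      funext x
      have := congrFun h (π x)
      simpa using this
    · intro h
      funext x
      have := congrFun h (π⁻¹ x)
      simpa using this
  have h2 : ((π.arrowCongr (Equiv.refl (Fin r))).symm e) = e ∘ π := by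
    funext x; simp [Equiv.arrowCongr]
  rw [h2]
  have h3 : ∏ j, (X (e j) : MvPolynomial (Fin r) ℤ) = ∏ j, X ((e ∘ π) j) := by
    simpa using (Equiv.prod_comp π (fun j => (X (e j) : MvPolynomial (Fin r) ℤ))).symm
  rw [h3]
  simp only [h1]

theorem eval_PW (r : ℕ) (w : Equiv.Perm α) : eval (fun _ => (1:ℤ)) (PW r w) = fixN r w := by
  unfold PW fixN
  rw [map_sum]
  refine Finset.sum_congr rfl fun e _ => ?_
  split_ifs <;> simp

theorem fixN_conj (r : ℕ) (w π : Equiv.Perm α) : fixN r (π * w * π⁻¹) = fixN r w := by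
  rw [← eval_PW, PW_conj, eval_PW]

theorem comp_perm_inv {β : Type} (e : α → β) (w : Equiv.Perm α) : e ∘ ⇑(w⁻¹) = e ↔ e ∘ w = e := by
  constructor
  · intro h
    funext x
    have := congrFun h (w x)
    simpa using this.symm
  · intro h
    funext x
    have := congrFun h (w⁻¹ x)
    simpa using this.symm

theorem fixN_inv (r : ℕ) (w : Equiv.Perm α) : fixN r w⁻¹ = fixN r w := by
  unfold fixN
  simp only [comp_perm_inv]

theorem RR_conj (p q : ℕ) (w π : Equiv.Perm α) : RR p q (π * w * π⁻¹) = RR p q w := by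
  unfold RR
  refine (Fintype.sum_equiv (MulAut.conj π).toEquiv _ _ ?_).symm
  intro v
  simp only [MulEquiv.toEquiv_eq_coe, MulEquiv.coe_toEquiv, MulAut.conj_apply]
  rw [fixN_conj q v π, show π * w * π⁻¹ * (π * v * π⁻¹)⁻¹ = π * (w * v⁻¹) * π⁻¹ by group,
    fixN_conj]
  congr 2
  rw [map_mul, map_mul, map_inv]
  rw [mul_comm (Equiv.Perm.sign π), mul_assoc, mul_inv_cancel, mul_one]

theorem fix_option {β : Type} (e : Option α → β) (w : Equiv.Perm α) :
    e ∘ ⇑(Equiv.optionCongr w) = e ↔ (e ∘ some) ∘ w = e ∘ some := by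
  constructor
  · intro h
    funext x
    simpa using congrFun h (some x)
  · intro h
    funext x
    cases x with
    | none => simp
    | some x => simpa using congrFun h x

theorem fix_option_swap {β : Type} (e : Option α → β) (w : Equiv.Perm α) (j : α) :
    e ∘ ⇑(Equiv.swap none (some j) * Equiv.optionCongr w) = e ↔
      ((e ∘ some) ∘ w = e ∘ some ∧ e none = e (some j)) := by
  have key : e none = e (some j) → e ∘ ⇑(Equiv.swap none (some j)) = e := by
    intro h
    funext x
    simp only [Function.comp]
    rw [Equiv.swap_apply_def]
    split_ifs with h1 h2
    · rw [h1, h]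
    · rw [h2, h]
    · rfl
  constructor
  · intro h
    have h0 : e none = e (some j) := by simpa using (congrFun h none).symm
    refine ⟨?_, h0⟩
    rw [← fix_option]
    rw [Equiv.Perm.coe_mul, ← Function.comp_assoc, key h0] at h
    exact h
  · rintro ⟨h, h0⟩
    rw [Equiv.Perm.coe_mul, ← Function.comp_assoc, key h0]
    rwa [fix_option]

theorem sum_option_fun {M β : Type} [Fintype β] [AddCommMonoid M] (f : (Option α → β) → M) :
    ∑ e : Option α → β, f e = ∑ b : β, ∑ e : α → β, f (fun x => x.elim b e) := by
  rw [← Fintype.sum_prod_type']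
  refine (Fintype.sum_equiv
    ((Equiv.piOptionEquivProd (α := α) (β := fun _ => β)).symm) _ _ ?_).symm
  rintro ⟨b, e⟩
  congr 1
  funext x
  cases x <;> rfl

theorem elim_comp_some {β : Type} (b : β) (e : α → β) :
    (fun x : Option α => x.elim b e) ∘ some = e := rfl

theorem PW_option (r : ℕ) (w : Equiv.Perm α) :
    PW r (Equiv.optionCongr w) = powerSumMv r 1 * PW r w := by
  unfold PW powerSumMv
  rw [sum_option_fun, Finset.sum_mul_sum]
  simp only [fix_option, elim_comp_some, Fintype.prod_option, Option.elim_none, Option.elim_some]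
  refine Finset.sum_congr rfl fun b _ => Finset.sum_congr rfl fun e _ => ?_
  split_ifs <;> simp

theorem fixN_option (r : ℕ) (w : Equiv.Perm α) :
    fixN r (Equiv.optionCongr w) = r * fixN r w := by
  unfold fixN
  rw [sum_option_fun]
  simp only [fix_option, elim_comp_some]
  simp

theorem fixN_option_swap (r : ℕ) (w : Equiv.Perm α) (j : α) :
    fixN r (Equiv.swap none (some j) * Equiv.optionCongr w) = fixN r w := by
  unfold fixN
  rw [sum_option_fun]
  simp only [fix_option_swap, elim_comp_some, Option.elim_none, Option.elim_some]
  rw [Finset.sum_comm]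
  refine Finset.sum_congr rfl fun e _ => ?_
  by_cases h : e ∘ w = e <;> simp [h]

theorem fixN_option_swap' (r : ℕ) (w : Equiv.Perm α) (j : α) :
    fixN r (Equiv.optionCongr w * Equiv.swap none (some j)) = fixN r w := by
  rw [← fixN_inv, mul_inv_rev, Equiv.swap_inv]
  have : (Equiv.optionCongr w : Equiv.Perm (Option α))⁻¹ = Equiv.optionCongr w⁻¹ := by
    ext x; cases x <;> rfl
  rw [this, fixN_option_swap, fixN_inv]

theorem RR_option (p q : ℕ) (w : Equiv.Perm α) :
    RR p q (Equiv.optionCongr w) = ((p * q : ℤ) - Fintype.card α) * RR p q w := by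
  unfold RR
  rw [← Equiv.sum_comp Equiv.Perm.decomposeOption.symm, Fintype.sum_prod_type,
    Fintype.sum_option]
  simp only [Equiv.Perm.decomposeOption_symm_apply]
  have hinv : ∀ v : Equiv.Perm α, (Equiv.optionCongr v : Equiv.Perm (Option α))⁻¹
      = Equiv.optionCongr v⁻¹ := by
    intro v; ext x; cases x <;> rfl
  have hmul : ∀ v : Equiv.Perm α, (Equiv.optionCongr w : Equiv.Perm (Option α)) *
      Equiv.optionCongr v = Equiv.optionCongr (w * v) := by
    intro v; ext x; cases x <;> rfl
  have hA : ∀ v : Equiv.Perm α,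
      fixN p (Equiv.optionCongr w * (Equiv.swap none none * Equiv.optionCongr v)⁻¹) *
        ((Equiv.Perm.sign (Equiv.swap none none * Equiv.optionCongr v : Equiv.Perm (Option α)) : ℤˣ) : ℤ)
         * fixN q (Equiv.swap none none * Equiv.optionCongr v)
        = (p * q : ℤ) * (fixN p (w * v⁻¹) * ((Equiv.Perm.sign v : ℤˣ) : ℤ) * fixN q v) := by
    intro v
    have h1 : (Equiv.swap none none * Equiv.optionCongr v : Equiv.Perm (Option α))
        = Equiv.optionCongr v := by
      rw [Equiv.swap_self]; ext x; rfl
    rw [h1, hinv, hmul, fixN_option, fixN_option, Equiv.optionCongr_sign]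
    ring
  have hB : ∀ (j : α) (v : Equiv.Perm α),
      fixN p (Equiv.optionCongr w * (Equiv.swap none (some j) * Equiv.optionCongr v)⁻¹) *
        ((Equiv.Perm.sign (Equiv.swap none (some j) * Equiv.optionCongr v : Equiv.Perm (Option α)) : ℤˣ) : ℤ)
         * fixN q (Equiv.swap none (some j) * Equiv.optionCongr v)
        = - (fixN p (w * v⁻¹) * ((Equiv.Perm.sign v : ℤˣ) : ℤ) * fixN q v) := by
    intro j v
    rw [mul_inv_rev, Equiv.swap_inv, hinv, ← mul_assoc, hmul, fixN_option_swap',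
      fixN_option_swap, map_mul, Equiv.Perm.sign_swap (by simp), Equiv.optionCongr_sign]
    simp
  simp only [hA, hB]
  rw [← Finset.mul_sum]
  simp
  ring

end basic

theorem RR_equiv {α β : Type} [Fintype α] [DecidableEq α] [Fintype β] [DecidableEq β]
    (p q : ℕ) (f : α ≃ β) (w : Equiv.Perm α) : RR p q (f.permCongr w) = RR p q w := by
  have hfix : ∀ (r : ℕ) (w : Equiv.Perm α), fixN r (f.permCongr w) = fixN r w := by
    intro r w
    unfold fixN
    refine Fintype.sum_equiv (f.arrowCongr (Equiv.refl _)).symm _ _ ?_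
    intro e
    have h2 : ((f.arrowCongr (Equiv.refl (Fin r))).symm e) = e ∘ f := by
      funext x; simp [Equiv.arrowCongr]
    rw [h2]
    have h1 : (e ∘ ⇑(f.permCongr w) = e) ↔ ((e ∘ f) ∘ w = e ∘ f) := by
      constructor
      · intro h
        funext x
        simpa using congrFun h (f x)
      · intro h
        funext x
        simpa using congrFun h (f.symm x)
    simp only [h1]
  unfold RR
  refine (Fintype.sum_equiv f.permCongr _ _ ?_).symm
  intro v
  rw [hfix, Equiv.Perm.sign_permCongr,
    show f.permCongr w * (f.permCongr v)⁻¹ = f.permCongr (w * v⁻¹) by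
      rw [mul_inv_eq_iff_eq_mul]; ext x; simp [Equiv.permCongr_apply], hfix]

theorem RR_one (p q : ℕ) (n : ℕ) : RR p q (1 : Equiv.Perm (Fin n)) = (p * q).descFactorial n := by
  induction n with
  | zero =>
    have h : ∀ (r : ℕ) (w : Equiv.Perm (Fin 0)), fixN r w = 1 := by
      intro r w
      unfold fixN
      rw [Fintype.sum_unique, if_pos (Subsingleton.elim _ _)]
    simp [RR, h]
  | succ n ih =>
    have h := RR_option p q (1 : Equiv.Perm (Fin n))
    rw [ih] at h
    rw [← RR_equiv p q (finSuccEquiv n)]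
    have : (finSuccEquiv n).permCongr 1 = Equiv.optionCongr (1 : Equiv.Perm (Fin n)) := by
      ext x; simp
    rw [this, h, Nat.descFactorial_succ]
    simp only [Fintype.card_fin]
    by_cases hn : n ≤ p * q
    · push_cast [Nat.cast_sub hn]; ring
    · rw [Nat.descFactorial_eq_zero_iff_lt.2 (by omega)]; simp

theorem RR_one' {α : Type} [Fintype α] [DecidableEq α] (p q : ℕ) :
    RR p q (1 : Equiv.Perm α) = (p * q).descFactorial (Fintype.card α) := by
  rw [← RR_one, ← RR_equiv p q (Fintype.equivFin α)]
  congr 1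
  ext x; simp

section orbits
variable {α : Type} [Fintype α] [DecidableEq α]

open Classical in
theorem prod_orbits {M : Type} [CommMonoid M] (w : Equiv.Perm α) (f : ℕ → M) :
    ∏ o : Quotient (Equiv.Perm.SameCycle.setoid w),
      f (Finset.univ.filter (fun j : α => (Quotient.mk (Equiv.Perm.SameCycle.setoid w) j) = o)).card
      = (w.partition.parts.map f).prod := by
  set S := Equiv.Perm.SameCycle.setoid w with hS
  have hmk : ∀ i j : α, Quotient.mk S i = Quotient.mk S j ↔ w.SameCycle i j := by
    intro i j
    exact Quotient.eq (r := S)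
  have hout : ∀ o : Quotient S, Quotient.mk S o.out = o := fun o => Quotient.out_eq o
  rw [Equiv.Perm.parts_partition, Multiset.map_add, Multiset.prod_add,
    ← Finset.prod_filter_mul_prod_filter_not Finset.univ (fun o : Quotient S => w o.out ≠ o.out)]
  congr 1
  · rw [Equiv.Perm.cycleType_def, Multiset.map_map]
    change _ = ∏ c ∈ w.cycleFactorsFinset, _
    refine Finset.prod_bij (fun o _ => w.cycleOf o.out) ?_ ?_ ?_ ?_
    · intro o ho
      rw [Equiv.Perm.cycleOf_mem_cycleFactorsFinset_iff, Equiv.Perm.mem_support]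
      exact (Finset.mem_filter.1 ho).2
    · intro o ho o' ho' h
      rw [← hout o, ← hout o', hmk]
      have hx : o'.out ∈ (w.cycleOf o.out).support := by
        rw [h, Equiv.Perm.mem_support_cycleOf_iff]
        exact ⟨Equiv.Perm.SameCycle.refl _ _, Equiv.Perm.mem_support.2 (Finset.mem_filter.1 ho').2⟩
      exact (Equiv.Perm.mem_support_cycleOf_iff.1 hx).1
    · intro c hc
      obtain ⟨hcyc, hceq⟩ := Equiv.Perm.mem_cycleFactorsFinset_iff.1 hc
      obtain ⟨x, hx⟩ := hcyc.nonempty_support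
      have hcx : c = w.cycleOf x := Equiv.Perm.cycle_is_cycleOf hx hc
      have hsc : w.SameCycle x (Quotient.mk S x).out := by
        rw [← hmk]; exact (hout _).symm
      have hxw : w x ≠ x := by
        rw [← hceq x hx]; exact Equiv.Perm.mem_support.1 hx
      refine ⟨Quotient.mk S x, ?_, ?_⟩
      · simp only [Finset.mem_filter, Finset.mem_univ, true_and]
        intro h
        exact hxw ((hsc.apply_eq_self_iff).2 h)
      · rw [hcx]; exact hsc.cycleOf_eq.symm
    · intro o ho
      have hne := (Finset.mem_filter.1 ho).2
      simp only [Function.comp]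
      congr 2
      ext j
      simp only [Finset.mem_filter, Finset.mem_univ, true_and]
      rw [Equiv.Perm.mem_support_cycleOf_iff]
      constructor
      · intro h
        refine ⟨?_, Equiv.Perm.mem_support.2 hne⟩
        rw [← hmk, h, hout]
      · intro h
        rw [← hout o, hmk]
        exact h.1.symm
  · have h1 : ∀ o ∈ Finset.univ.filter (fun o : Quotient S => ¬ (w o.out ≠ o.out)),
        f (Finset.univ.filter (fun j : α => Quotient.mk S j = o)).card = f 1 := by
      intro o ho
      have heq : w o.out = o.out := not_not.1 (Finset.mem_filter.1 ho).2
      congr 1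
      rw [Finset.card_eq_one]
      refine ⟨o.out, ?_⟩
      ext j
      simp only [Finset.mem_filter, Finset.mem_univ, true_and, Finset.mem_singleton]
      constructor
      · intro h
        have : w.SameCycle o.out j := by rw [← hmk, h, hout]
        exact (this.eq_of_left heq).symm
      · rintro rfl; exact hout o
    rw [Finset.prod_congr rfl h1, Finset.prod_const, Multiset.map_replicate,
      Multiset.prod_replicate]
    congr 1
    rw [← Finset.card_compl]
    refine Finset.card_bij (fun o _ => o.out) ?_ ?_ ?_
    · intro o ho
      have heq : w o.out = o.out := not_not.1 (Finset.mem_filter.1 ho).2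
      simp [heq]
    · intro o _ o' _ h
      rw [← hout o, ← hout o', h]
    · intro j hj
      have hj' : w j = j := by simpa using hj
      have hsc : w.SameCycle j (Quotient.mk S j).out := by
        rw [← hmk]; exact (hout _).symm
      have : (Quotient.mk S j).out = j := (hsc.eq_of_left hj').symm
      refine ⟨Quotient.mk S j, ?_, this⟩
      simp [this, hj']

open Classical in
theorem PW_eq (r : ℕ) (w : Equiv.Perm α) :
    PW r w = (w.partition.parts.map (powerSumMv r)).prod := by
  rw [← prod_orbits]
  unfold PW powerSumMv
  set S := Equiv.Perm.SameCycle.setoid w with hS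
  rw [Finset.prod_univ_sum, Fintype.piFinset_univ, ← Finset.sum_filter]
  symm
  refine Finset.sum_bij (fun g _ => fun j => g (Quotient.mk S j)) ?_ ?_ ?_ ?_
  · intro g _
    simp only [Finset.mem_filter, Finset.mem_univ, true_and]
    funext j
    simp only [Function.comp]
    congr 1
    exact Quotient.sound (s := S) (Equiv.Perm.sameCycle_apply_left.2 (Equiv.Perm.SameCycle.refl _ _))
  · intro g _ g' _ h
    funext o
    obtain ⟨j, rfl⟩ := Quotient.exists_rep o
    exact congrFun h j
  · intro e he
    have he' : e ∘ w = e := (Finset.mem_filter.1 he).2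
    have hz : ∀ (n : ℤ) (x : α), e ((w ^ n) x) = e x := by
      intro n x
      induction n using Int.induction_on generalizing x with
      | zero => simp
      | succ n ih => rw [zpow_add_one, Equiv.Perm.mul_apply, ih]; exact congrFun he' x
      | pred n ih =>
        rw [zpow_sub_one, Equiv.Perm.mul_apply, ih]
        exact congrFun ((comp_perm_inv e w).2 he') x
    refine ⟨Quotient.lift e ?_, Finset.mem_univ _, rfl⟩
    rintro a b ⟨n, hn⟩
    rw [← hn, hz]
  · intro g _
    rw [← Finset.prod_fiberwise_of_maps_to (s := Finset.univ) (t := Finset.univ)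
      (g := fun j : α => Quotient.mk S j) (fun _ _ => Finset.mem_univ _)]
    refine Finset.prod_congr rfl fun o _ => ?_
    rw [← Finset.prod_const]
    refine Finset.prod_congr rfl fun j hj => ?_
    change X (g o) = X (g (Quotient.mk S j))
    rw [(Finset.mem_filter.1 hj).2]

theorem fixN_eq (r : ℕ) (w : Equiv.Perm α) :
    fixN r w = (r : ℤ) ^ w.partition.parts.card := by
  rw [← eval_PW, PW_eq, map_multiset_prod, Multiset.map_map]
  have : (fun x => (eval fun _ => (1:ℤ)) (powerSumMv r x)) = fun _ => (r : ℤ) := by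
    funext x; simp [powerSumMv]
  change (Multiset.map (fun x => (eval fun _ => (1:ℤ)) (powerSumMv r x)) _).prod = _
  rw [this, Multiset.map_const', Multiset.prod_replicate]

theorem sign_parts (v : Equiv.Perm α) :
    ((Equiv.Perm.sign v : ℤˣ) : ℤ) = (-1) ^ Fintype.card α * (-1) ^ v.partition.parts.card := by
  rw [Equiv.Perm.sign_of_cycleType, Equiv.Perm.parts_partition, Multiset.card_add,
    Multiset.card_replicate, Equiv.Perm.sum_cycleType]
  have h : v.support.card ≤ Fintype.card α := Finset.card_le_univ _
  obtain ⟨d, hd⟩ := Nat.exists_eq_add_of_le h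
  rw [hd]
  push_cast
  rw [Nat.add_sub_cancel_left, ← pow_add,
    show v.support.card + d + (v.cycleType.card + d) = v.support.card + v.cycleType.card + 2 * d by
      ring, pow_add _ _ (2 * d), pow_mul]
  simp

end orbits

theorem RR_eq_sum (p q k : ℕ) (w : Equiv.Perm (Fin k)) :
    (-1) ^ k *
        ∑ uv ∈ Finset.univ.filter
            (fun uv : Equiv.Perm (Fin k) × Equiv.Perm (Fin k) => uv.1 * uv.2 = w),
          (p : ℚ) ^ cyclesCount uv.1 * (-(q : ℚ)) ^ cyclesCount uv.2 = (RR p q w : ℚ) := by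
  unfold RR
  rw [Finset.mul_sum]
  push_cast
  refine Finset.sum_bij (fun uv _ => uv.2) (fun _ _ => Finset.mem_univ _) ?_ ?_ ?_
  · rintro ⟨u, v⟩ h ⟨u', v'⟩ h' e
    simp only [Finset.mem_filter, Finset.mem_univ, true_and] at h h' e
    subst e
    have : u = u' := mul_right_cancel (h.trans h'.symm)
    rw [this]
  · intro v _
    exact ⟨(w * v⁻¹, v), by simp, rfl⟩
  · rintro ⟨u, v⟩ h
    simp only [Finset.mem_filter, Finset.mem_univ, true_and] at h
    have : w * v⁻¹ = u := by rw [← h]; group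
    simp only [this, fixN_eq, sign_parts, cyclesCount, Fintype.card_fin]
    push_cast
    rw [neg_pow]
    ring

section perp
variable {α : Type} [Fintype α] [DecidableEq α]

/-- If a class of functionals vanishes on unbalanced colourings, only the rectangular
monomial survives. -/
theorem sum_PW_of_balanced (r q : ℕ) (f : Equiv.Perm α → ℤ)
    (hf : ∀ e : α → Fin r, (∃ i, (Finset.univ.filter (fun j => e j = i)).card ≠ q) →
      ∑ w : Equiv.Perm α, (if e ∘ w = e then f w else 0) = 0) :
    ∃ t : ℤ, ∑ w, C (f w) * PW r w = C t * ∏ i : Fin r, X i ^ q := by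
  have h1 : ∑ w, C (f w) * PW r w = ∑ e : α → Fin r,
      C (∑ w : Equiv.Perm α, if e ∘ w = e then f w else 0) * ∏ j, X (e j) := by
    unfold PW
    simp only [Finset.mul_sum]
    rw [Finset.sum_comm]
    refine Finset.sum_congr rfl fun e _ => ?_
    rw [map_sum, Finset.sum_mul]
    refine Finset.sum_congr rfl fun w _ => ?_
    split_ifs <;> simp
  refine ⟨∑ e : α → Fin r, ∑ w : Equiv.Perm α, (if e ∘ w = e then f w else 0), ?_⟩
  rw [h1, map_sum, Finset.sum_mul]
  refine Finset.sum_congr rfl fun e _ => ?_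
  by_cases he : ∃ i, (Finset.univ.filter (fun j => e j = i)).card ≠ q
  · rw [hf e he]; simp
  · push Not at he
    congr 1
    rw [← Finset.prod_fiberwise_of_maps_to (s := Finset.univ) (t := Finset.univ)
      (g := e) (fun _ _ => Finset.mem_univ _)]
    refine Finset.prod_congr rfl fun i _ => ?_
    rw [← he i, ← Finset.prod_const]
    refine Finset.prod_congr rfl fun j hj => ?_
    rw [(Finset.mem_filter.1 hj).2]

theorem exists_large (r q : ℕ) (hc : Fintype.card α = r * q) (e : α → Fin r)
    (he : ∃ i, (Finset.univ.filter (fun j => e j = i)).card ≠ q) :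
    ∃ i, q < (Finset.univ.filter (fun j => e j = i)).card := by
  by_contra hcon
  push Not at hcon
  obtain ⟨i, hi⟩ := he
  have hsum : Fintype.card α = ∑ i, (Finset.univ.filter (fun j => e j = i)).card :=
    Finset.card_eq_sum_card_fiberwise (fun _ _ => Finset.mem_univ _)
  have hlt : ∑ i, (Finset.univ.filter (fun j => e j = i)).card < ∑ _i : Fin r, q :=
    Finset.sum_lt_sum (fun i _ => hcon i) ⟨i, Finset.mem_univ _, lt_of_le_of_ne (hcon i) hi⟩
  simp at hlt
  omega

theorem swap_fix {β : Type} (e : α → β) (i j : α) (h : e i = e j) :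
    e ∘ ⇑(Equiv.swap i j) = e := by
  funext x
  simp only [Function.comp]
  rw [Equiv.swap_apply_def]
  split_ifs with h1 h2
  · rw [h1, h]
  · rw [h2, h]
  · rfl

theorem signed_cancel {r q : ℕ} (d : α → Fin q) (e e' : α → Fin r)
    (i : Fin r) (hi : q < (Finset.univ.filter (fun j => e j = i)).card) :
    ∑ v : Equiv.Perm α, (if d ∘ v = d then (if e ∘ v = e' then
      ((Equiv.Perm.sign v : ℤˣ) : ℤ) else 0) else 0) = 0 := by
  obtain ⟨x, hx, y, hy, hxy, hd⟩ := Finset.exists_ne_map_eq_of_card_lt_of_maps_to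
    (s := Finset.univ.filter (fun j => e j = i)) (t := (Finset.univ : Finset (Fin q)))
    (by simpa using hi) (f := d) (fun _ _ => Finset.mem_coe.2 (Finset.mem_univ _))
  simp only [Finset.mem_filter, Finset.mem_univ, true_and] at hx hy
  have he := swap_fix e x y (hx.trans hy.symm)
  have hd' := swap_fix d x y hd
  set S := ∑ v : Equiv.Perm α, (if d ∘ v = d then (if e ∘ v = e' then
      ((Equiv.Perm.sign v : ℤˣ) : ℤ) else 0) else 0) with hS
  have : S = -S := by
    conv_lhs => rw [hS, ← Equiv.sum_comp (Equiv.mulLeft (Equiv.swap x y))]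
    rw [hS, ← Finset.sum_neg_distrib]
    refine Finset.sum_congr rfl fun v _ => ?_
    simp only [Equiv.coe_mulLeft, Equiv.Perm.coe_mul, ← Function.comp_assoc, he, hd', map_mul,
      Equiv.Perm.sign_swap hxy]
    split_ifs <;> simp
  omega

theorem RR_perp (r q : ℕ) (hc : Fintype.card α = r * q) (e : α → Fin r)
    (he : ∃ i, (Finset.univ.filter (fun j => e j = i)).card ≠ q) :
    ∑ w : Equiv.Perm α, (if e ∘ w = e then RR r q w else 0) = 0 := by
  obtain ⟨i, hi⟩ := exists_large r q hc e he
  have h1 : ∑ w : Equiv.Perm α, (if e ∘ w = e then RR r q w else 0)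
      = ∑ v : Equiv.Perm α, ∑ u : Equiv.Perm α, (if e ∘ ⇑(u * v) = e then
          fixN r u * ((Equiv.Perm.sign v : ℤˣ) : ℤ) * fixN q v else 0) := by
    unfold RR
    have : ∀ w : Equiv.Perm α, (if e ∘ w = e then ∑ v : Equiv.Perm α,
        fixN r (w * v⁻¹) * ((Equiv.Perm.sign v : ℤˣ) : ℤ) * fixN q v else 0)
        = ∑ v : Equiv.Perm α, if e ∘ w = e then
          fixN r (w * v⁻¹) * ((Equiv.Perm.sign v : ℤˣ) : ℤ) * fixN q v else 0 := by
      intro w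
      split_ifs <;> simp
    rw [Finset.sum_congr rfl fun w _ => this w, Finset.sum_comm]
    refine Finset.sum_congr rfl fun v _ => ?_
    rw [← Equiv.sum_comp (Equiv.mulRight v)]
    refine Finset.sum_congr rfl fun u _ => ?_
    simp only [Equiv.coe_mulRight, mul_inv_cancel_right]
  rw [h1, Finset.sum_comm]
  refine Finset.sum_eq_zero fun u _ => ?_
  have hi' : q < (Finset.univ.filter (fun j => (e ∘ u) j = i)).card := by
    convert hi using 1
    refine Finset.card_bij (fun j _ => u j) ?_ ?_ ?_
    · intro j hj; simpa using hj
    · intro a _ b _ h; exact u.injective h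
    · intro b hb; exact ⟨u⁻¹ b, by simpa using hb, by simp⟩
  have h2 : ∀ v : Equiv.Perm α, (if e ∘ ⇑(u * v) = e then
          fixN r u * ((Equiv.Perm.sign v : ℤˣ) : ℤ) * fixN q v else 0)
      = fixN r u * ∑ d : α → Fin q, (if d ∘ v = d then (if (e ∘ u) ∘ v = e then
      ((Equiv.Perm.sign v : ℤˣ) : ℤ) else 0) else 0) := by
    intro v
    rw [Equiv.Perm.coe_mul, ← Function.comp_assoc]
    by_cases h : (e ∘ u) ∘ v = e
    · simp only [h, if_true]
      conv_lhs => rw [fixN.eq_1 q]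
      rw [mul_assoc, Finset.mul_sum]
      congr 1
      refine Finset.sum_congr rfl fun d _ => ?_
      split_ifs <;> simp
    · simp [h]
  rw [Finset.sum_congr rfl fun v _ => h2 v, ← Finset.mul_sum, Finset.sum_comm]
  rw [Finset.sum_eq_zero fun d _ => signed_cancel d (e ∘ u) e i hi', mul_zero]

end perp

section schurweyl
variable {α : Type} [Fintype α] [DecidableEq α]

/-- Trace of `w` composed with the tensor power of a matrix. -/
def TrW {R : Type} [CommRing R] {r : ℕ} (Z : Matrix (Fin r) (Fin r) R) (w : Equiv.Perm α) : R :=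
  ∑ c : α → Fin r, ∏ j, Z (c j) (c (w j))

theorem TrW_diagonal {R : Type} [CommRing R] {r : ℕ} (x : Fin r → R) (w : Equiv.Perm α) :
    TrW (Matrix.diagonal x) w = aeval x (PW r w) := by
  unfold TrW PW
  rw [map_sum]
  refine Finset.sum_congr rfl fun c _ => ?_
  split_ifs with h
  · rw [map_prod]
    refine Finset.prod_congr rfl fun j _ => ?_
    have : c (w j) = c j := congrFun h j
    rw [this, Matrix.diagonal_apply_eq, aeval_X]
  · have : ∃ j, c (w j) ≠ c j := by
      by_contra hcon
      push Not at hcon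
      exact h (funext hcon)
    obtain ⟨j, hj⟩ := this
    rw [map_zero]
    exact Finset.prod_eq_zero (Finset.mem_univ j) (Matrix.diagonal_apply_ne _ (Ne.symm hj))

theorem TrW_mul_comm {R : Type} [CommRing R] {r : ℕ} (A B : Matrix (Fin r) (Fin r) R)
    (w : Equiv.Perm α) : TrW (A * B) w = TrW (B * A) w := by
  have h : ∀ A B : Matrix (Fin r) (Fin r) R, TrW (A * B) w =
      ∑ c : α → Fin r, ∑ d : α → Fin r, ∏ j, (A (c j) (d j) * B (d j) (c (w j))) := by
    intro A B
    unfold TrW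
    refine Finset.sum_congr rfl fun c _ => ?_
    simp only [Matrix.mul_apply]
    rw [Finset.prod_univ_sum, Fintype.piFinset_univ]
  rw [h, h, Finset.sum_comm]
  refine Finset.sum_congr rfl fun d _ => ?_
  rw [← Equiv.sum_comp (w.arrowCongr (Equiv.refl (Fin r))) ]
  refine Finset.sum_congr rfl fun c _ => ?_
  rw [Finset.prod_mul_distrib, Finset.prod_mul_distrib]
  rw [← Equiv.prod_comp w (fun j => A ((w.arrowCongr (Equiv.refl (Fin r))) c j) (d j)), mul_comm]
  simp [Equiv.arrowCongr]

theorem TrW_hermitian {r : ℕ} (h : Equiv.Perm α → ℤ) (hh : ∑ w, C (h w) * PW r w = 0)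
    (A : Matrix (Fin r) (Fin r) ℂ) (hA : A.IsHermitian) :
    ∑ w : Equiv.Perm α, (h w : ℂ) * TrW A w = 0 := by
  have hsp := hA.spectral_theorem
  rw [Unitary.conjStarAlgAut_apply] at hsp
  have h1 : ∀ w : Equiv.Perm α, TrW A w
      = TrW (Matrix.diagonal (RCLike.ofReal ∘ hA.eigenvalues : Fin r → ℂ)) w := by
    intro w
    conv_lhs => rw [hsp]
    rw [TrW_mul_comm, ← mul_assoc]
    simp
  simp only [h1, TrW_diagonal]
  have := congrArg (aeval (RCLike.ofReal ∘ hA.eigenvalues : Fin r → ℂ)) hh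
  rw [map_sum, map_zero] at this
  rw [← this]
  refine Finset.sum_congr rfl fun w _ => ?_
  simp

theorem TrW_all {r : ℕ} (h : Equiv.Perm α → ℤ) (hh : ∑ w, C (h w) * PW r w = 0)
    (Z : Matrix (Fin r) (Fin r) ℂ) :
    ∑ w : Equiv.Perm α, (h w : ℂ) * TrW Z w = 0 := by
  set A : Matrix (Fin r) (Fin r) ℂ := (1/2 : ℂ) • (Z + Z.conjTranspose) with hAdef
  set B : Matrix (Fin r) (Fin r) ℂ := (-Complex.I/2 : ℂ) • (Z - Z.conjTranspose) with hBdef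
  have hA : A.IsHermitian := by
    rw [Matrix.IsHermitian, hAdef, Matrix.conjTranspose_smul, Matrix.conjTranspose_add,
      Matrix.conjTranspose_conjTranspose, add_comm]
    simp
  have hB : B.IsHermitian := by
    rw [Matrix.IsHermitian, hBdef, Matrix.conjTranspose_smul, Matrix.conjTranspose_sub,
      Matrix.conjTranspose_conjTranspose, ← neg_sub Z, smul_neg, ← neg_smul]
    congr 1
    simp [neg_div]
  have hZ : Z = A + Complex.I • B := by
    rw [hAdef, hBdef, smul_smul]
    have : Complex.I * (-Complex.I / 2) = 1/2 := by
      rw [mul_div_assoc', mul_neg, Complex.I_mul_I]; norm_num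
    rw [this, ← smul_add]
    ext i j
    simp
    ring
  let P : Polynomial ℂ := ∑ w : Equiv.Perm α, Polynomial.C (h w : ℂ) *
    TrW (A.map Polynomial.C + (Polynomial.X : Polynomial ℂ) • B.map Polynomial.C) w
  have hP : ∀ s : ℂ, P.eval s = ∑ w : Equiv.Perm α, (h w : ℂ) * TrW (A + s • B) w := by
    intro s
    simp only [P, TrW, Polynomial.eval_finsetSum, Polynomial.eval_mul, Polynomial.eval_C,
      Polynomial.eval_prod, Matrix.add_apply, Matrix.smul_apply, Matrix.map_apply,
      Polynomial.eval_add, smul_eq_mul, Polynomial.eval_X]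
  have hP0 : P = 0 := by
    refine Polynomial.eq_zero_of_infinite_isRoot P ?_
    refine Set.Infinite.mono ?_ (Set.infinite_range_of_injective Complex.ofReal_injective)
    rintro _ ⟨s, rfl⟩
    change P.eval _ = 0
    rw [hP]
    refine TrW_hermitian h hh _ ?_
    refine hA.add ?_
    rw [Matrix.IsHermitian, Matrix.conjTranspose_smul, hB.eq]
    simp
  rw [hZ, ← hP, hP0, Polynomial.eval_zero]

theorem schur_weyl {r : ℕ} (h : Equiv.Perm α → ℤ) (hh : ∑ w, C (h w) * PW r w = 0)
    (hcl : ∀ w π : Equiv.Perm α, h (π * w * π⁻¹) = h w) (a b : α → Fin r) :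
    ∑ w : Equiv.Perm α, (if a ∘ w = b then h w else 0) = 0 := by
  let Z : Matrix (Fin r) (Fin r) (MvPolynomial α ℂ) :=
    fun i k => ∑ j : α, X j * (if i = a j ∧ k = b j then 1 else 0)
  let Q : MvPolynomial α ℂ := ∑ w : Equiv.Perm α, C (h w : ℂ) * TrW Z w
  have hQ : Q = 0 := by
    refine MvPolynomial.funext fun t => ?_
    rw [map_zero]
    have := TrW_all h hh (Z.map (eval t))
    rw [← this]
    simp only [Q, TrW, map_sum, map_mul, eval_C, map_prod, Matrix.map_apply]
  have hexp : ∀ w : Equiv.Perm α, TrW Z w = ∑ φ : α → α, ∑ c : α → Fin r,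
      (∏ i, X (φ i)) * (if ∀ i, c i = a (φ i) ∧ c (w i) = b (φ i) then 1 else 0) := by
    intro w
    unfold TrW
    rw [Finset.sum_comm]
    refine Finset.sum_congr rfl fun c _ => ?_
    simp only [Z]
    rw [Finset.prod_univ_sum, Fintype.piFinset_univ]
    refine Finset.sum_congr rfl fun φ _ => ?_
    rw [Finset.prod_mul_distrib, Finset.prod_ite_zero]
    simp
  have hmon : ∀ φ : α → α, (∏ i, X (φ i) : MvPolynomial α ℂ)
      = monomial (∑ i, Finsupp.single (φ i) 1) 1 := by
    intro φ
    rw [monomial_sum_one]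
    rfl
  let one' : α →₀ ℕ := Finsupp.equivFunOnFinite.symm (fun _ => 1)
  have hco : ∀ φ : α → α, coeff one' (∏ i, X (φ i) : MvPolynomial α ℂ)
      = if Function.Bijective φ then 1 else 0 := by
    intro φ
    rw [hmon, coeff_monomial]
    congr 1
    rw [eq_iff_iff]
    have hval : ∀ x, (∑ i, Finsupp.single (φ i) 1 : α →₀ ℕ) x
        = (Finset.univ.filter (fun i => φ i = x)).card := by
      intro x
      rw [Finsupp.finsetSum_apply, Finset.card_filter]
      refine Finset.sum_congr rfl fun i _ => ?_
      rw [Finsupp.single_apply]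
    constructor
    · intro he
      rw [← Finite.surjective_iff_bijective]
      intro x
      have h1 := hval x
      rw [he] at h1
      have h2 : 0 < (Finset.univ.filter (fun i => φ i = x)).card := by
        rw [← h1]; exact Nat.one_pos
      obtain ⟨i, hi⟩ := Finset.card_pos.1 h2
      exact ⟨i, (Finset.mem_filter.1 hi).2⟩
    · intro hb
      ext x
      rw [hval]
      change _ = 1
      rw [Finset.card_eq_one]
      obtain ⟨i, hi, hu⟩ := hb.existsUnique x
      refine ⟨i, ?_⟩
      ext j
      simp only [Finset.mem_filter, Finset.mem_univ, true_and, Finset.mem_singleton]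
      exact ⟨fun hj => hu j hj, fun hj => hj ▸ hi⟩
  have hcoef : ∀ w : Equiv.Perm α, coeff one' (TrW Z w)
      = ∑ π : Equiv.Perm α, if a ∘ ⇑(π * w * π⁻¹) = b then 1 else 0 := by
    intro w
    have h3 : coeff one' (TrW Z w) = ∑ φ : α → α, if Function.Bijective φ then
        (if (a ∘ φ) ∘ w = b ∘ φ then (1:ℂ) else 0) else 0 := by
      rw [hexp, coeff_sum]
      refine Finset.sum_congr rfl fun φ _ => ?_
      rw [coeff_sum]
      have : ∀ c : α → Fin r, coeff one' ((∏ i, X (φ i) : MvPolynomial α ℂ) *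
          (if ∀ i, c i = a (φ i) ∧ c (w i) = b (φ i) then 1 else 0))
          = if c = a ∘ φ then (if Function.Bijective φ then
        (if (a ∘ φ) ∘ w = b ∘ φ then (1:ℂ) else 0) else 0) else 0 := by
        intro c
        by_cases hc : c = a ∘ φ
        · subst hc
          simp only [Function.comp, true_and, if_true]
          by_cases hc2 : ∀ i, a (φ (w i)) = b (φ i)
          · have hc3 : (a ∘ φ) ∘ w = b ∘ φ := _root_.funext hc2
            rw [if_pos hc2, mul_one, hco, if_pos hc3]
          · have hc3 : ¬ ((a ∘ φ) ∘ w = b ∘ φ) := fun h => hc2 (congrFun h)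
            rw [if_neg hc2, mul_zero, coeff_zero, if_neg hc3]
            simp
        · rw [if_neg hc, if_neg, mul_zero, coeff_zero]
          intro h
          exact hc (_root_.funext fun i => (h i).1)
      rw [Finset.sum_congr rfl fun c _ => this c, Finset.sum_ite_eq' ]
      simp
    rw [h3, ← Finset.sum_filter]
    symm
    refine Finset.sum_bij (fun π _ => ⇑π) ?_ ?_ ?_ ?_
    · intro π _; simp
    · intro π _ π' _ h; exact DFunLike.coe_injective h
    · intro φ hφ
      exact ⟨Equiv.ofBijective φ (Finset.mem_filter.1 hφ).2, Finset.mem_univ _, rfl⟩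
    · intro π _
      have : (a ∘ ⇑(π * w * π⁻¹) = b) ↔ ((a ∘ π) ∘ w = b ∘ π) := by
        constructor
        · intro h
          funext x
          simpa using congrFun h (π x)
        · intro h
          funext x
          simpa using congrFun h (π⁻¹ x)
      simp only [this]
  have hfin : coeff one' Q = ∑ w : Equiv.Perm α, ∑ π : Equiv.Perm α,
      ((if a ∘ ⇑(π * w * π⁻¹) = b then h (π * w * π⁻¹) else 0 : ℤ) : ℂ) := by
    simp only [Q, coeff_sum, coeff_C_mul, hcoef, Finset.mul_sum]
    refine Finset.sum_congr rfl fun w _ => Finset.sum_congr rfl fun π _ => ?_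
    rw [hcl]
    split_ifs <;> simp
  rw [hQ, coeff_zero, Finset.sum_comm] at hfin
  have h4 : ∀ π : Equiv.Perm α, ∑ w : Equiv.Perm α,
      ((if a ∘ ⇑(π * w * π⁻¹) = b then h (π * w * π⁻¹) else 0 : ℤ) : ℂ)
      = ((∑ w : Equiv.Perm α, (if a ∘ w = b then h w else 0) : ℤ) : ℂ) := by
    intro π
    rw [Int.cast_sum]
    exact Fintype.sum_equiv (MulAut.conj π).toEquiv _ _ (fun w => by
      simp only [MulEquiv.toEquiv_eq_coe, MulEquiv.coe_toEquiv, MulAut.conj_apply]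
      rfl)
  rw [Finset.sum_congr rfl fun π _ => h4 π, Finset.sum_const, Finset.card_univ, nsmul_eq_mul,
    eq_comm, mul_eq_zero] at hfin
  rcases hfin with h5 | h5
  · exact absurd h5 (Nat.cast_ne_zero.2 Fintype.card_ne_zero)
  · exact_mod_cast h5

theorem RR_pair {r q : ℕ} (h : Equiv.Perm α → ℤ) (hh : ∑ w, C (h w) * PW r w = 0)
    (hcl : ∀ w π : Equiv.Perm α, h (π * w * π⁻¹) = h w) :
    ∑ w : Equiv.Perm α, h w * RR r q w = 0 := by
  unfold RR fixN
  simp only [Finset.mul_sum, Finset.sum_mul]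
  rw [Finset.sum_comm]
  refine Finset.sum_eq_zero fun v _ => ?_
  rw [Finset.sum_comm]
  refine Finset.sum_eq_zero fun d _ => ?_
  rw [Finset.sum_comm]
  refine Finset.sum_eq_zero fun c _ => ?_
  have key := schur_weyl h hh hcl c (c ∘ v)
  have : ∀ w : Equiv.Perm α, (c ∘ ⇑(w * v⁻¹) = c) ↔ (c ∘ w = c ∘ v) := by
    intro w
    constructor
    · intro h
      funext x
      simpa using congrFun h (v x)
    · intro h
      funext x
      simpa using congrFun h (v⁻¹ x)
  simp only [this]
  calc _ = ∑ w : Equiv.Perm α, (if c ∘ w = c ∘ v then h w else 0) *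
        (((Equiv.Perm.sign v : ℤˣ) : ℤ) * (if d ∘ v = d then 1 else 0)) := by
        refine Finset.sum_congr rfl fun w _ => ?_
        split_ifs <;> ring
    _ = 0 := by rw [← Finset.sum_mul, key, zero_mul]

end schurweyl

section frob

theorem prod_X_monomial {A : Type} [Fintype A] {r : ℕ} (c : A → Fin r) :
    (∏ k, X (c k) : MvPolynomial (Fin r) ℤ) = monomial (∑ k, Finsupp.single (c k) 1) 1 := by
  rw [monomial_sum_one]
  rfl

theorem content_apply {A : Type} [Fintype A] {r : ℕ} (c : A → Fin r) (j : Fin r) :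
    (∑ k, Finsupp.single (c k) 1 : Fin r →₀ ℕ) j = Fintype.card {k // c k = j} := by
  rw [Finsupp.finsetSum_apply, Fintype.card_subtype, Finset.card_filter]
  refine Finset.sum_congr rfl fun i _ => ?_
  rw [Finsupp.single_apply]

/-- Weighted sum of colourings, equal to `m!` times the complete homogeneous polynomial. -/
noncomputable def HS (A : Type) [Fintype A] [DecidableEq A] (r : ℕ) : MvPolynomial (Fin r) ℤ :=
  ∑ c : A → Fin r, C ((∏ j, (Fintype.card {k // c k = j}).factorial : ℕ) : ℤ) * ∏ k, X (c k)

theorem coeff_HS (A : Type) [Fintype A] [DecidableEq A] (r : ℕ) (γ : Fin r →₀ ℕ) :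
    coeff γ (HS A r) = if ∑ i, γ i = Fintype.card A then ((Fintype.card A).factorial : ℤ) else 0 := by
  have hpow : (∑ i, X i : MvPolynomial (Fin r) ℤ) ^ (Fintype.card A)
      = ∑ c : A → Fin r, ∏ k, X (c k) := by
    rw [← Finset.card_univ, ← Finset.prod_const, Finset.prod_univ_sum, Fintype.piFinset_univ]
  have hsum : γ.sum (fun _ m => m) = ∑ i, γ i := by
    rw [Finsupp.sum_fintype _ _ (fun _ => rfl)]
  have h1 : coeff γ (HS A r) = (∏ j, (γ j).factorial : ℕ) *
      coeff γ ((∑ i, X i : MvPolynomial (Fin r) ℤ) ^ (Fintype.card A)) := by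
    rw [hpow, HS, coeff_sum, coeff_sum, Finset.mul_sum]
    refine Finset.sum_congr rfl fun c _ => ?_
    rw [coeff_C_mul, prod_X_monomial, coeff_monomial]
    split_ifs with h
    · congr 2
      refine Finset.prod_congr rfl fun j _ => ?_
      rw [← h, content_apply]
    · simp
  rw [h1, coeff_sum_X_pow_of_fintype, hsum]
  split_ifs with h
  · rw [Finsupp.multinomial_eq_of_support_subset (Finset.subset_univ _)]
    have := Nat.multinomial_spec Finset.univ (γ : Fin r → ℕ)
    rw [h] at this
    exact_mod_cast this
  · simp

/-- The exponent vector of a permutation. -/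
noncomputable def dperm {r : ℕ} (σ : Equiv.Perm (Fin r)) : Fin r →₀ ℕ :=
  Finsupp.equivFunOnFinite.symm (fun i => (σ i : ℕ))

theorem vandermonde_expand (r : ℕ) : vandermondeMv r =
    C (∏ i : Fin r, (-1 : ℤ) ^ (i : ℕ)) *
      ∑ σ : Equiv.Perm (Fin r), monomial (dperm σ) ((Equiv.Perm.sign σ : ℤˣ) : ℤ) := by
  have h1 : vandermondeMv r =
      (Matrix.vandermonde (fun i : Fin r => (-X i : MvPolynomial (Fin r) ℤ))).det := by
    rw [Matrix.det_vandermonde, vandermondeMv, Finset.prod_filter, Fintype.prod_prod_type]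
    refine Finset.prod_congr rfl fun i _ => ?_
    rw [← Finset.prod_filter]
    refine Finset.prod_congr ?_ ?_
    · ext j; simp
    · intro j _; ring
  rw [h1, ← Matrix.det_transpose, Matrix.det_apply', Finset.mul_sum]
  refine Finset.sum_congr rfl fun σ _ => ?_
  have h2 : ∏ i : Fin r, (Matrix.vandermonde (fun i : Fin r => (-X i : MvPolynomial (Fin r) ℤ))).transpose (σ i) i
      = C (∏ i : Fin r, (-1 : ℤ) ^ (i : ℕ)) * monomial (dperm σ) 1 := by
    simp only [Matrix.transpose_apply, Matrix.vandermonde_apply]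
    simp only [neg_pow (X _ : MvPolynomial (Fin r) ℤ)]
    rw [Finset.prod_mul_distrib]
    congr 1
    · rw [Equiv.prod_comp σ (fun j : Fin r => (-1 : MvPolynomial (Fin r) ℤ) ^ (j : ℕ))]
      simp
    · rw [monomial_eq, C_1, one_mul, Finsupp.prod_fintype _ _ (fun _ => pow_zero _)]
      rfl
  rw [h2]
  have h3 : monomial (dperm σ) ((Equiv.Perm.sign σ : ℤˣ) : ℤ)
      = C ((Equiv.Perm.sign σ : ℤˣ) : ℤ) * monomial (dperm σ) 1 := by
    rw [C_mul_monomial, mul_one]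
  rw [h3, ← mul_assoc, ← mul_assoc, mul_comm (C _) (C _)]
  congr 2

theorem det_zero_one (r m : ℕ) (B : Fin r → ℕ) (i₀ : Fin r)
    (hB : ∀ i, B i < m + r - 1) (hs : ∑ i, B i = m + ∑ i : Fin r, (i : ℕ)) :
    ∑ σ : Equiv.Perm (Fin r), (if ∀ i, (σ i : ℕ) ≤ B i then ((Equiv.Perm.sign σ : ℤˣ) : ℤ) else 0)
      = 0 := by
  have hr : 0 < r := i₀.pos
  have hdet : ∑ σ : Equiv.Perm (Fin r),
      (if ∀ i, (σ i : ℕ) ≤ B i then ((Equiv.Perm.sign σ : ℤˣ) : ℤ) else 0)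
      = (Matrix.of (fun i j : Fin r => if (j : ℕ) ≤ B i then (1 : ℤ) else 0)).det := by
    rw [← Matrix.det_transpose, Matrix.det_apply']
    refine Finset.sum_congr rfl fun σ _ => ?_
    simp only [Matrix.transpose_apply, Matrix.of_apply]
    rw [Finset.prod_ite_zero]
    simp
  rw [hdet]
  let g : Fin r → Fin r := fun i => ⟨min (B i) (r - 1), by omega⟩
  have hg : ¬ Function.Injective g := by
    intro hinj
    have hbij := Finite.injective_iff_bijective.1 hinj
    obtain ⟨i1, hi1⟩ := hbij.2 ⟨r - 1, by omega⟩
    have hsumg : ∑ i, (g i : ℕ) = ∑ i : Fin r, (i : ℕ) :=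
      Equiv.sum_comp (Equiv.ofBijective g hbij) (fun i : Fin r => (i : ℕ))
    rw [← Finset.add_sum_erase _ _ (Finset.mem_univ i1)] at hsumg hs
    have hoth : ∑ i ∈ Finset.univ.erase i1, B i = ∑ i ∈ Finset.univ.erase i1, (g i : ℕ) := by
      refine Finset.sum_congr rfl fun i hi => ?_
      have hne : g i ≠ g i1 := fun h => (Finset.ne_of_mem_erase hi) (hinj h)
      rw [hi1] at hne
      have hne' : (g i : ℕ) ≠ r - 1 := fun h => hne (Fin.ext h)
      simp only [g] at hne' ⊢
      omega
    have h2 : (g i1 : ℕ) = r - 1 := by rw [hi1]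
    have := hB i1
    omega
  rw [Function.not_injective_iff] at hg
  obtain ⟨i, j, hij, hne⟩ := hg
  refine Matrix.det_zero_of_row_eq hne ?_
  funext k
  simp only [Matrix.of_apply]
  have h1 : min (B i) (r - 1) = min (B j) (r - 1) := congrArg Fin.val hij
  have h2 := k.isLt
  congr 1
  rw [eq_iff_iff]
  omega

theorem coeff_vand_HS (A : Type) [Fintype A] [DecidableEq A] (r : ℕ) (B : Fin r →₀ ℕ) (i₀ : Fin r)
    (hB : ∀ i, B i < Fintype.card A + r - 1) :
    coeff B (vandermondeMv r * HS A r) = 0 := by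
  rw [vandermonde_expand, mul_assoc, coeff_C_mul, Finset.sum_mul, coeff_sum]
  simp only [coeff_monomial_mul', coeff_HS]
  have hle : ∀ σ : Equiv.Perm (Fin r), dperm σ ≤ B ↔ ∀ i, (σ i : ℕ) ≤ B i := fun σ => Iff.rfl
  have hsub : ∀ σ : Equiv.Perm (Fin r), dperm σ ≤ B →
      ∑ i, (B - dperm σ) i + ∑ i : Fin r, (i : ℕ) = ∑ i, B i := by
    intro σ h
    rw [← Equiv.sum_comp σ (fun i : Fin r => (i : ℕ)), ← Finset.sum_add_distrib]
    refine Finset.sum_congr rfl fun i _ => ?_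
    exact Nat.sub_add_cancel (h i)
  rw [mul_eq_zero]
  right
  by_cases hs : ∑ i, B i = Fintype.card A + ∑ i : Fin r, (i : ℕ)
  · have := det_zero_one r (Fintype.card A) B i₀ hB hs
    refine Eq.trans ?_ ((congrArg (fun z : ℤ => z * ((Fintype.card A).factorial : ℤ)) this).trans
      (zero_mul _))
    rw [Finset.sum_mul]
    refine Finset.sum_congr rfl fun σ _ => ?_
    by_cases h : dperm σ ≤ B
    · have h2 := hsub σ h
      rw [if_pos h, if_pos ((hle σ).1 h), if_pos (by omega)]
    · rw [if_neg h, if_neg (fun h' => h ((hle σ).2 h')), zero_mul]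
  · refine Finset.sum_eq_zero fun σ _ => ?_
    by_cases h : dperm σ ≤ B
    · have h2 := hsub σ h
      rw [if_pos h, if_neg (by omega), mul_zero]
    · rw [if_neg h]

theorem coeff_vand_HS_mul (A : Type) [Fintype A] [DecidableEq A] (r : ℕ) (B : Fin r →₀ ℕ)
    (i₀ : Fin r) (hB : ∀ i, B i < Fintype.card A + r - 1) (G : MvPolynomial (Fin r) ℤ) :
    coeff B (vandermondeMv r * (HS A r * G)) = 0 := by
  rw [← mul_assoc, coeff_mul]
  refine Finset.sum_eq_zero fun x hx => ?_
  rw [Finset.HasAntidiagonal.mem_antidiagonal] at hx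
  rw [coeff_vand_HS A r x.1 i₀ ?_, zero_mul]
  intro i
  refine lt_of_le_of_lt ?_ (hB i)
  rw [← hx]
  simp

theorem sum_stab_PW {α : Type} [Fintype α] [DecidableEq α] (r : ℕ) (e : α → Fin r) (i₀ : Fin r) :
    ∃ G : MvPolynomial (Fin r) ℤ,
      ∑ w : Equiv.Perm α, (if e ∘ w = e then PW r w else 0) = HS {k // e k = i₀} r * G := by
  have h1 : ∑ w : Equiv.Perm α, (if e ∘ w = e then PW r w else 0)
      = ∑ c : α → Fin r, C ((∏ x : Fin r × Fin r,
          (Fintype.card {k // (e k, c k) = x}).factorial : ℕ) : ℤ) * ∏ k, X (c k) := by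
    have h2 : ∀ w : Equiv.Perm α, (if e ∘ w = e then PW r w else 0)
        = ∑ c : α → Fin r, if (fun k => (e k, c k)) ∘ w = (fun k => (e k, c k)) then
          ∏ k, (X (c k) : MvPolynomial (Fin r) ℤ) else 0 := by
      intro w
      have h3 : ∀ c : α → Fin r, ((fun k => (e k, c k)) ∘ w = (fun k => (e k, c k))) ↔
          (e ∘ w = e ∧ c ∘ w = c) := by
        intro c
        simp only [funext_iff, Function.comp, Prod.mk.injEq, forall_and]
      simp only [h3]
      by_cases h : e ∘ w = e
      · simp only [h, if_true, true_and, PW]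
      · simp only [h, if_false, false_and, Finset.sum_const_zero]
    rw [Finset.sum_congr rfl fun w _ => h2 w, Finset.sum_comm]
    refine Finset.sum_congr rfl fun c _ => ?_
    rw [← Finset.sum_filter, Finset.sum_const, ← DomMulAct.stabilizer_card, Fintype.card_subtype,
      nsmul_eq_mul]
    simp
  let K : ({k // ¬ e k = i₀} → Fin r) → ℕ := fun c' =>
    ∏ i ∈ Finset.univ.erase i₀, ∏ j : Fin r,
      (Fintype.card {k : {k // ¬ e k = i₀} // e k = i ∧ c' k = j}).factorial
  refine ⟨∑ c' : {k // ¬ e k = i₀} → Fin r, C (K c' : ℤ) * ∏ k, X (c' k), ?_⟩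
  rw [h1, HS, Finset.sum_mul_sum, ← Fintype.sum_prod_type']
  refine Fintype.sum_equiv (Equiv.piEquivPiSubtypeProd (fun k => e k = i₀) (fun _ => Fin r)) _ _ ?_
  intro c
  simp only [Equiv.piEquivPiSubtypeProd_apply]
  have hX : (∏ k, X (c k) : MvPolynomial (Fin r) ℤ) =
      (∏ k : {k // e k = i₀}, X (c k)) * ∏ k : {k // ¬ e k = i₀}, X (c k) :=
    (Fintype.prod_subtype_mul_prod_subtype (fun k => e k = i₀) (fun k => X (c k))).symm
  have hK : (∏ x : Fin r × Fin r, (Fintype.card {k // (e k, c k) = x}).factorial)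
      = (∏ j : Fin r, (Fintype.card {k : {k // e k = i₀} // c k = j}).factorial) *
        K (fun k => c k) := by
    rw [Fintype.prod_prod_type, ← Finset.mul_prod_erase _ _ (Finset.mem_univ i₀)]
    congr 1
    · refine Finset.prod_congr rfl fun j _ => ?_
      congr 1
      refine Fintype.card_congr ?_
      refine ((Equiv.subtypeSubtypeEquivSubtypeInter (fun k => e k = i₀) (fun k => c k = j)).trans
        (Equiv.subtypeEquivRight ?_)).symm
      intro k; simp
    · refine Finset.prod_congr rfl fun i hi => Finset.prod_congr rfl fun j _ => ?_
      congr 1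
      refine Fintype.card_congr ?_
      refine ((Equiv.subtypeSubtypeEquivSubtypeInter (fun k => ¬ e k = i₀)
        (fun k => e k = i ∧ c k = j)).trans (Equiv.subtypeEquivRight ?_)).symm
      intro k
      have := Finset.ne_of_mem_erase hi
      simp only [Prod.mk.injEq]
      constructor
      · exact fun h => h.2
      · intro h
        exact ⟨by rw [h.1]; exact this, h⟩
  rw [hX, hK]
  push_cast
  rw [C_mul]
  ring

theorem Phi_perp {α : Type} [Fintype α] [DecidableEq α] (r q : ℕ) (hc : Fintype.card α = r * q)
    (B : Fin r →₀ ℕ) (hB : ∀ i, B i ≤ q + (r - 1)) (e : α → Fin r)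
    (he : ∃ i, (Finset.univ.filter (fun j => e j = i)).card ≠ q) :
    ∑ w : Equiv.Perm α, (if e ∘ w = e then coeff B (vandermondeMv r * PW r w) else 0) = 0 := by
  obtain ⟨i₀, hi⟩ := exists_large r q hc e he
  obtain ⟨G, hG⟩ := sum_stab_PW r e i₀
  have h : ∑ w : Equiv.Perm α, (if e ∘ w = e then coeff B (vandermondeMv r * PW r w) else 0)
      = coeff B (vandermondeMv r * ∑ w : Equiv.Perm α, (if e ∘ w = e then PW r w else 0)) := by
    rw [Finset.mul_sum, coeff_sum]
    refine Finset.sum_congr rfl fun w _ => ?_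
    split_ifs <;> simp
  rw [h, hG]
  refine coeff_vand_HS_mul _ r B i₀ ?_ G
  intro i
  have := hB i
  have := i₀.pos
  rw [Fintype.card_subtype]
  omega

end frob

section main
variable {α : Type} [Fintype α] [DecidableEq α]

/-- The exponent of the rectangular shape. -/
noncomputable def rectB (r q : ℕ) : Fin r →₀ ℕ :=
  Finsupp.equivFunOnFinite.symm (fun i => q + (r - 1 - (i : ℕ)))

theorem coeff_delta (r : ℕ) : coeff (dperm (Fin.revPerm : Equiv.Perm (Fin r))) (vandermondeMv r) ≠ 0 := by
  have hinj : ∀ σ τ : Equiv.Perm (Fin r), dperm σ = dperm τ ↔ σ = τ := by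
    intro σ τ
    constructor
    · intro h
      refine Equiv.ext fun i => Fin.ext ?_
      exact DFunLike.congr_fun h i
    · rintro rfl; rfl
  rw [vandermonde_expand, coeff_C_mul, coeff_sum]
  simp only [coeff_monomial, hinj, Finset.sum_ite_eq', Finset.mem_univ, if_true]
  refine mul_ne_zero ?_ (Units.ne_zero _)
  exact Finset.prod_ne_zero_iff.2 fun i _ => pow_ne_zero _ (by norm_num)

theorem coeff_rect (r q : ℕ) (t : ℤ) :
    coeff (rectB r q) (vandermondeMv r * (C t * ∏ i : Fin r, X i ^ q)) =
      t * coeff (dperm (Fin.revPerm : Equiv.Perm (Fin r))) (vandermondeMv r) := by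
  have h1 : (∏ i : Fin r, X i ^ q : MvPolynomial (Fin r) ℤ)
      = monomial (Finsupp.equivFunOnFinite.symm (fun _ : Fin r => q)) 1 := by
    rw [monomial_eq, C_1, one_mul, Finsupp.prod_fintype _ _ (fun _ => pow_zero _)]
    rfl
  have h2 : rectB r q = dperm (Fin.revPerm : Equiv.Perm (Fin r))
      + Finsupp.equivFunOnFinite.symm (fun _ : Fin r => q) := by
    ext i
    simp only [rectB, dperm, Finsupp.add_apply, Finsupp.coe_equivFunOnFinite_symm, Fin.revPerm_apply,
      Fin.val_rev]
    omega
  rw [h1, mul_left_comm, coeff_C_mul, h2, coeff_mul_monomial, mul_one]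

theorem Phi_RR (r q : ℕ) (hc : Fintype.card α = r * q) :
    coeff (rectB r q) (vandermondeMv r * PW r (1 : Equiv.Perm α)) ≠ 0 ∧
    ∀ w : Equiv.Perm α, ((r * q).factorial : ℤ) * coeff (rectB r q) (vandermondeMv r * PW r w)
      = RR r q w * coeff (rectB r q) (vandermondeMv r * PW r (1 : Equiv.Perm α)) := by
  let Φ : Equiv.Perm α → ℤ := fun w => coeff (rectB r q) (vandermondeMv r * PW r w)
  have hΦ : ∀ w, coeff (rectB r q) (vandermondeMv r * PW r w) = Φ w := fun _ => rfl
  have hΦcl : ∀ w π : Equiv.Perm α, Φ (π * w * π⁻¹) = Φ w := by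
    intro w π
    simp only [Φ, PW_conj]
  have hpair : ∀ h : Equiv.Perm α → ℤ, ∑ w, h w * Φ w
      = coeff (rectB r q) (vandermondeMv r * ∑ w, C (h w) * PW r w) := by
    intro h
    rw [Finset.mul_sum, coeff_sum]
    refine Finset.sum_congr rfl fun w _ => ?_
    rw [mul_left_comm, coeff_C_mul]
  obtain ⟨t, ht⟩ := sum_PW_of_balanced r q (RR r q : Equiv.Perm α → ℤ) (RR_perp r q hc)
  obtain ⟨s, hs⟩ := sum_PW_of_balanced r q Φ
    (Phi_perp r q hc (rectB r q) (fun i => by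
      simp only [rectB, Finsupp.coe_equivFunOnFinite_symm]; omega))
  have hR1 : RR r q (1 : Equiv.Perm α) = (r * q).factorial := by
    rw [RR_one', hc, Nat.descFactorial_self]
  have hR1' : RR r q (1 : Equiv.Perm α) ≠ 0 := by
    rw [hR1]; exact_mod_cast (r * q).factorial_ne_zero
  have ht0 : t ≠ 0 := by
    rintro rfl
    rw [C_0, zero_mul] at ht
    have := RR_pair (q := q) _ ht (fun w π => RR_conj r q w π)
    rw [Finset.sum_eq_zero_iff_of_nonneg (fun w _ => mul_self_nonneg _)] at this
    exact hR1' (mul_self_eq_zero.1 (this 1 (Finset.mem_univ _)))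
  have hh0 : ∀ w, s * RR r q w - t * Φ w = 0 := by
    let h : Equiv.Perm α → ℤ := fun w => s * RR r q w - t * Φ w
    have hh : ∑ w, C (h w) * PW r w = 0 := by
      have : ∑ w, C (h w) * PW r w
          = C s * ∑ w : Equiv.Perm α, C (RR r q w) * PW r w - C t * ∑ w, C (Φ w) * PW r w := by
        rw [Finset.mul_sum, Finset.mul_sum, ← Finset.sum_sub_distrib]
        refine Finset.sum_congr rfl fun w _ => ?_
        simp only [h, C_sub, C_mul]
        ring
      rw [this, ht, hs]
      ring
    have hcl : ∀ w π : Equiv.Perm α, h (π * w * π⁻¹) = h w := by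
      intro w π
      simp only [h, hΦcl, RR_conj]
    have e1 := RR_pair (q := q) h hh hcl
    have e2 := hpair h
    rw [hh, mul_zero, coeff_zero] at e2
    have e3 : ∑ w, h w * h w = 0 := by
      have : ∑ w, h w * h w = s * ∑ w, h w * RR r q w - t * ∑ w, h w * Φ w := by
        rw [Finset.mul_sum, Finset.mul_sum, ← Finset.sum_sub_distrib]
        refine Finset.sum_congr rfl fun w _ => ?_
        simp only [h]
        ring
      rw [this, e1, e2]; simp
    rw [Finset.sum_eq_zero_iff_of_nonneg (fun w _ => mul_self_nonneg _)] at e3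
    intro w
    exact mul_self_eq_zero.1 (e3 w (Finset.mem_univ _))
  have hs0 : s ≠ 0 := by
    rintro rfl
    have hz : ∀ w, Φ w = 0 := by
      intro w
      have := hh0 w
      rw [zero_mul, zero_sub, neg_eq_zero, mul_eq_zero] at this
      exact this.resolve_left ht0
    have e := hpair (RR r q)
    rw [ht, coeff_rect] at e
    simp only [hz, mul_zero, Finset.sum_const_zero] at e
    exact mul_ne_zero ht0 (coeff_delta r) e.symm
  have h1 := hh0 1
  simp only [hΦ]
  constructor
  · intro h
    rw [h, mul_zero, sub_zero] at h1
    exact mul_ne_zero hs0 hR1' h1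
  · intro w
    have h2 := hh0 w
    rw [hR1] at h1
    refine mul_left_cancel₀ (mul_ne_zero ht0 hs0) ?_
    linear_combination (s * RR r q w) * h1 - s * ((r * q).factorial : ℤ) * h2

theorem exists_extension (r q k : ℕ) (w : Equiv.Perm (Fin k)) (m : ℕ) (hm : k + m ≤ r * q) :
    ∃ (β : Type) (_ : Fintype β) (_ : DecidableEq β) (w' : Equiv.Perm β),
      Fintype.card β = k + m ∧ PW r w' = powerSumMv r 1 ^ m * PW r w ∧
      ((r * q - k - m).factorial : ℤ) * RR r q w' = ((r * q - k).factorial : ℤ) * RR r q w := by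
  induction m with
  | zero => exact ⟨Fin k, inferInstance, inferInstance, w, by simp, by simp, by simp⟩
  | succ m ih =>
    obtain ⟨β, i1, i2, w', hc, hP, hR⟩ := ih (by omega)
    refine ⟨Option β, inferInstance, inferInstance, Equiv.optionCongr w', ?_, ?_, ?_⟩
    · rw [Fintype.card_option, hc]; rfl
    · rw [PW_option, hP, pow_succ]; ring
    · rw [RR_option, hc, ← hR]
      obtain ⟨d, hd⟩ : ∃ d, r * q = k + m + 1 + d := ⟨_, (Nat.add_sub_of_le (by omega)).symm⟩
      have e1 : r * q - k - (m + 1) = d := by omega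
      have e2 : r * q - k - m = d + 1 := by omega
      rw [e1, e2, Nat.factorial_succ]
      have e3 : (r * q : ℤ) = k + m + 1 + d := by exact_mod_cast hd
      rw [e3]
      push_cast
      ring

theorem PW_one (r : ℕ) : PW r (1 : Equiv.Perm α) = powerSumMv r 1 ^ Fintype.card α := by
  simp only [PW, powerSumMv, Equiv.Perm.coe_one, Function.comp_id, if_true, pow_one]
  rw [← Finset.card_univ, ← Finset.prod_const, Finset.prod_univ_sum, Fintype.piFinset_univ]

theorem main_general (r q k : ℕ) (hk : k ≤ r * q) (w : Equiv.Perm (Fin k)) :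
    ((r * q).descFactorial k : ℚ)
        * (coeff (rectB r q) (vandermondeMv r *
          ((w.partition.parts + Multiset.replicate (r * q - k) 1).map (powerSumMv r)).prod) : ℤ)
        / (coeff (rectB r q) (vandermondeMv r *
          ((Multiset.replicate (r * q) 1).map (powerSumMv r)).prod) : ℤ)
      = (RR r q w : ℚ) := by
  obtain ⟨β, i1, i2, w', hc, hP, hR⟩ := exists_extension r q k w (r * q - k) (by omega)
  have hc' : Fintype.card β = r * q := by omega
  obtain ⟨h0, h1⟩ := Phi_RR (α := β) r q hc'
  have hw := h1 w'
  rw [PW_one, hc'] at h0 hw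
  rw [hP, PW_eq] at hw
  simp only [Multiset.map_add, Multiset.map_replicate, Multiset.prod_add, Multiset.prod_replicate]
  rw [mul_comm (powerSumMv r 1 ^ _)] at hw
  rw [Nat.sub_self, Nat.factorial_zero, Nat.cast_one, one_mul] at hR
  rw [hR] at hw
  have h0' : ((coeff (rectB r q) (vandermondeMv r * powerSumMv r 1 ^ (r * q)) : ℤ) : ℚ) ≠ 0 := by
    exact_mod_cast h0
  rw [div_eq_iff h0']
  norm_cast
  have hf := Nat.factorial_mul_descFactorial hk
  have hfz : ((r * q - k).factorial : ℤ) ≠ 0 := by exact_mod_cast Nat.factorial_ne_zero _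
  refine mul_left_cancel₀ hfz ?_
  rw [← hf] at hw
  push_cast at hw ⊢
  linear_combination hw

end main

theorem rectangular_character_formula (p q k : ℕ) (hp : 1 ≤ p) (hq : 1 ≤ q)
    (hk : k ≤ p * q) (μ : Nat.Partition k) (w : Equiv.Perm (Fin k))
    (hw : w.partition.parts = μ.parts) :
    ((p * q).descFactorial k : ℚ)
        * (symChar (List.replicate p q) (μ.parts + Multiset.replicate (p * q - k) 1) : ℚ)
        / (symChar (List.replicate p q) (Multiset.replicate (p * q) 1) : ℚ)
      = (-1) ^ k *
        ∑ uv ∈ Finset.univ.filter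
            (fun uv : Equiv.Perm (Fin k) × Equiv.Perm (Fin k) => uv.1 * uv.2 = w),
          (p : ℚ) ^ cyclesCount uv.1 * (-(q : ℚ)) ^ cyclesCount uv.2 := by
  rw [RR_eq_sum, ← hw]
  have key : ∀ ν : Multiset ℕ, symChar (List.replicate p q) ν
      = coeff (rectB p q) (vandermondeMv p * (ν.map (powerSumMv p)).prod) := by
    intro ν
    have gen : ∀ L : List ℕ, (∀ i : Fin L.length, L.get i = q) → ∀ r, L.length = r →
        symChar L ν = coeff (rectB r q) (vandermondeMv r * (ν.map (powerSumMv r)).prod) := by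
      intro L hL r hr
      subst hr
      simp only [symChar, rectB, hL]
    exact gen _ (fun i => by simp) p List.length_replicate
  rw [key, key]
  exact main_general p q k hk w
end

section
/- Let p, q ≥ 1 and let μ be a partition of k with k ≤ pq. Then the normalized character satisfies χ̂^{p×q}(μ, 1^{pq−k}) = H_{p×q} · Σ_λ χ^λ(μ) / H_{λ̃}, where the sum is over all partitions λ of k contained in the rectangle p×q, λ̃ is the complementary partition λ̃_i = q − λ_{p+1−i} (taking λ = (λ_1,…,λ_p) with parts possibly zero), and H_ν denotes the product of the hook lengths of the shape ν. -/
open MvPolynomial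

/-- The `j`-th part (0-indexed) of the conjugate of the partition listed by `L`. -/
def conjPart (L : List ℕ) (j : ℕ) : ℕ :=
  ((List.range L.length).filter (fun i => j < L.getD i 0)).length

/-- The hook length of the (0-indexed) cell `(i,j)` of the partition listed by `L`. -/
def hookLen (L : List ℕ) (i j : ℕ) : ℤ :=
  (L.getD i 0 : ℤ) + (conjPart L j : ℤ) - (i : ℤ) - (j : ℤ) - 1

/-- `H_λ`: the product of all hook lengths of the partition listed by `L`. -/
def hookProd (L : List ℕ) : ℚ :=
  ∏ i ∈ Finset.range L.length, ∏ j ∈ Finset.range (L.getD i 0), (hookLen L i j : ℚ)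

lemma aux_int_prod (l : ℕ) : ∏ x ∈ Finset.Icc (1:ℤ) (l:ℤ), x = (l.factorial : ℤ) := by
  induction l with
  | zero => simp
  | succ l ih =>
    have : Finset.Icc (1:ℤ) ((l+1:ℕ):ℤ) = insert ((l:ℤ)+1) (Finset.Icc (1:ℤ) (l:ℤ)) := by
      ext x; simp only [Finset.mem_Icc, Finset.mem_insert]; push_cast; omega
    rw [this, Finset.prod_insert (by simp), ih, Nat.factorial_succ]
    push_cast; ring

lemma aux_conj (L : List ℕ) (hL : ∀ i j, i ≤ j → L.getD j 0 ≤ L.getD i 0) (s j : ℕ) :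
    s < conjPart L j ↔ j < L.getD s 0 := by
  have hc : conjPart L j = ((Finset.range L.length).filter (fun i => j < L.getD i 0)).card := by
    rfl
  rw [hc]
  constructor
  · intro h
    by_contra hn
    have : (Finset.range L.length).filter (fun i => j < L.getD i 0) ⊆ Finset.range s := by
      intro x hx
      simp only [Finset.mem_filter, Finset.mem_range] at hx ⊢
      by_contra hxs
      have := hL s x (by omega)
      omega
    have := Finset.card_le_card this
    simp only [Finset.card_range] at this
    omega
  · intro h
    have hs : s < L.length := by
      by_contra hn
      rw [List.getD_eq_default _ _ (by omega)] at h
      omega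
    have : Finset.range (s+1) ⊆ (Finset.range L.length).filter (fun i => j < L.getD i 0) := by
      intro x hx
      simp only [Finset.mem_filter, Finset.mem_range] at hx ⊢
      have := hL x s (by omega)
      omega
    have := Finset.card_le_card this
    simp only [Finset.card_range] at this
    omega

lemma aux_hook_row (L : List ℕ) (hL : ∀ i j, i ≤ j → L.getD j 0 ≤ L.getD i 0) (i : ℕ)
    (hi : i < L.length) :
    (∏ j ∈ Finset.range (L.getD i 0), hookLen L i j) *
      ∏ s ∈ Finset.Ioo i L.length, ((L.getD i 0 : ℤ) - i - L.getD s 0 + s)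
      = ((L.getD i 0 + (L.length - 1 - i)).factorial : ℤ) := by
  have hC := aux_conj L hL
  set n := L.length with hn
  have hbig : ∀ s, n ≤ s → L.getD s 0 = 0 := fun s hs => List.getD_eq_default _ _ hs
  generalize hν : (fun s => L.getD s 0) = ν at *
  have hν' : ∀ s, L.getD s 0 = ν s := fun s => by rw [← hν]
  simp only [hν'] at hL hC hbig ⊢
  generalize hc : (fun s => conjPart L s) = c at *
  have hc' : ∀ s, conjPart L s = c s := fun s => by rw [← hc]
  have hh : ∀ j, hookLen L i j = (ν i : ℤ) + c j - i - j - 1 := by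
    intro j; simp only [hookLen, hν', hc']
  simp only [hc'] at hC
  simp only [hh]
  have key : ∀ s j, (s + 1 ≤ c j ∧ j + 1 ≤ ν s) ∨ (c j ≤ s ∧ ν s ≤ j) := by
    intro s j
    have := hC s j
    omega
  have cn : ∀ j, c j ≤ n := by
    intro j
    rcases key n j with h | h
    · have := hbig n le_rfl; omega
    · exact h.1
  have canti : ∀ j j', j ≤ j' → c j' ≤ c j := by
    intro j j' h
    rcases key (c j) j with h1 | h1
    · omega
    · rcases key (c j) j' with h2 | h2 <;> omega
  have i1 : Set.InjOn (fun j : ℕ => (ν i : ℤ) + c j - i - j - 1) (Finset.range (ν i)) := by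
    intro a _ b _ hab
    simp only at hab
    rcases le_total a b with h | h
    · have := canti a b h; omega
    · have := canti b a h; omega
  have i2 : Set.InjOn (fun s : ℕ => (ν i : ℤ) - i - ν s + s) (Finset.Ioo i n) := by
    intro a _ b _ hab
    simp only at hab
    rcases le_total a b with h | h
    · have := hL a b h; omega
    · have := hL b a h; omega
  have hdisj : Disjoint ((Finset.range (ν i)).image (fun j : ℕ => (ν i : ℤ) + c j - i - j - 1))
      ((Finset.Ioo i n).image (fun s : ℕ => (ν i : ℤ) - i - ν s + s)) := by
    rw [Finset.disjoint_left]
    intro x hx hy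
    simp only [Finset.mem_image] at hx hy
    obtain ⟨j, _, hj⟩ := hx
    obtain ⟨s, _, hs⟩ := hy
    rcases key s j with h | h <;> omega
  have hU : (Finset.range (ν i)).image (fun j : ℕ => (ν i : ℤ) + c j - i - j - 1) ∪
      (Finset.Ioo i n).image (fun s : ℕ => (ν i : ℤ) - i - ν s + s) =
      Finset.Icc (1:ℤ) ((ν i + (n - 1 - i) : ℕ) : ℤ) := by
    apply Finset.eq_of_subset_of_card_le
    · intro x hx
      simp only [Finset.mem_union, Finset.mem_image, Finset.mem_range, Finset.mem_Ioo,
        Finset.mem_Icc] at hx ⊢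
      rcases hx with ⟨j, hj, rfl⟩ | ⟨s, hs, rfl⟩
      · have := cn j
        rcases key i j with h | h <;> omega
      · have := hL i s (by omega)
        omega
    · rw [Finset.card_union_of_disjoint hdisj, Finset.card_image_of_injOn i1,
        Finset.card_image_of_injOn i2]
      simp
      omega
  rw [← aux_int_prod, ← hU, Finset.prod_union hdisj, Finset.prod_image i1, Finset.prod_image i2]

lemma aux_hook (L : List ℕ) (hL : ∀ i j, i ≤ j → L.getD j 0 ≤ L.getD i 0) :
    hookProd L * ∏ i ∈ Finset.range L.length, ∏ s ∈ Finset.Ioo i L.length,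
        ((L.getD i 0 : ℚ) - i - L.getD s 0 + s)
      = ∏ i ∈ Finset.range L.length, ((L.getD i 0 + (L.length - 1 - i)).factorial : ℚ) := by
  rw [hookProd, ← Finset.prod_mul_distrib]
  apply Finset.prod_congr rfl
  intro i hi
  have := congrArg (fun z : ℤ => (z : ℚ)) (aux_hook_row L hL i (Finset.mem_range.1 hi))
  push_cast at this
  exact_mod_cast this

/-- Exponent vector of a function. -/
noncomputable def auxE {p : ℕ} (γ : Fin p → ℕ) : Fin p →₀ ℕ := Finsupp.equivFunOnFinite.symm γ

/-- The alternating polynomial `a_δ p_M`. -/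
noncomputable def auxA (p : ℕ) (M : Multiset ℕ) : MvPolynomial (Fin p) ℤ :=
  vandermondeMv p * (M.map (powerSumMv p)).prod

lemma auxE_apply {p : ℕ} (γ : Fin p → ℕ) (i : Fin p) : auxE γ i = γ i := rfl

lemma aux_vdm_det (p : ℕ) : vandermondeMv p =
    (Matrix.of fun i j : Fin p => (X i : MvPolynomial (Fin p) ℤ) ^ (j.rev : ℕ)).det := by
  have h1 : (Matrix.of fun i j : Fin p => (X i : MvPolynomial (Fin p) ℤ) ^ (j.rev : ℕ)) =
      (Matrix.vandermonde (fun i : Fin p => (X i.rev : MvPolynomial (Fin p) ℤ))).submatrix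
        Fin.revPerm Fin.revPerm := by
    ext i j
    simp [Matrix.vandermonde_apply]
  rw [h1, Matrix.det_submatrix_equiv_self, Matrix.det_vandermonde, vandermondeMv,
    Finset.prod_sigma']
  refine Finset.prod_bij' (fun x _ => ⟨x.2.rev, x.1.rev⟩) (fun y _ => (y.2.rev, y.1.rev))
    ?_ ?_ ?_ ?_ ?_
  · intro x hx
    simp only [Finset.mem_filter] at hx
    simp [hx]
  · rintro ⟨a, b⟩ hx
    simp at hx
    simp [hx]
  · intro x hx
    simp
  · rintro ⟨a, b⟩ hx
    simp
  · intro x hx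
    simp

lemma aux_vdm_rename (p : ℕ) (w : Equiv.Perm (Fin p)) :
    rename w (vandermondeMv p) = ((Equiv.Perm.sign w : ℤ) : MvPolynomial (Fin p) ℤ)
      * vandermondeMv p := by
  rw [aux_vdm_det, AlgHom.map_det, ← Matrix.det_permute]
  congr 1
  ext i j
  simp

lemma aux_A_rename (p : ℕ) (M : Multiset ℕ) (w : Equiv.Perm (Fin p)) :
    rename w (auxA p M) = ((Equiv.Perm.sign w : ℤ) : MvPolynomial (Fin p) ℤ) * auxA p M := by
  have h : rename w ((M.map (powerSumMv p)).prod) = (M.map (powerSumMv p)).prod := by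
    induction M using Multiset.induction_on with
    | empty => simp
    | cons a s ih =>
      simp only [Multiset.map_cons, Multiset.prod_cons, map_mul, ih]
      congr 1
      simp only [powerSumMv, map_sum, map_pow, rename_X]
      exact Equiv.sum_comp w (fun i => (X i : MvPolynomial (Fin p) ℤ) ^ a)
  rw [auxA, map_mul, h, aux_vdm_rename, mul_assoc]

lemma aux_coeff_perm (p : ℕ) (M : Multiset ℕ) (w : Equiv.Perm (Fin p)) (γ : Fin p → ℕ) :
    coeff (auxE (γ ∘ w)) (auxA p M) = (Equiv.Perm.sign w : ℤ) * coeff (auxE γ) (auxA p M) := by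
  have h := coeff_rename_mapDomain w w.injective (auxA p M) (auxE (γ ∘ w))
  have h2 : Finsupp.mapDomain w (auxE (γ ∘ w)) = auxE γ := by
    ext i
    rw [Finsupp.mapDomain_equiv_apply]
    simp [auxE_apply]
  rw [h2, aux_A_rename, ← map_intCast (C : ℤ →+* MvPolynomial (Fin p) ℤ), coeff_C_mul] at h
  rw [← h]; simp

lemma aux_coeff_noninj (p : ℕ) (M : Multiset ℕ) (γ : Fin p → ℕ) (h : ¬ Function.Injective γ) :
    coeff (auxE γ) (auxA p M) = 0 := by
  simp only [Function.Injective, not_forall] at h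
  obtain ⟨i, j, hij, hne⟩ := h
  have h1 := aux_coeff_perm p M (Equiv.swap i j) γ
  have h2 : γ ∘ (Equiv.swap i j) = γ := by
    ext x
    simp only [Function.comp_apply, Equiv.swap_apply_def]
    split_ifs <;> simp_all
  rw [h2, Equiv.Perm.sign_swap hne] at h1
  simp at h1
  omega

lemma aux_A_hom (p : ℕ) (M : Multiset ℕ) :
    (auxA p M).IsHomogeneous (∑ i : Fin p, (i.rev : ℕ) + M.sum) := by
  apply IsHomogeneous.mul
  · rw [aux_vdm_det, Matrix.det_apply']
    apply IsHomogeneous.sum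
    intro σ _
    rw [← zero_add (∑ i : Fin p, (i.rev : ℕ))]
    apply IsHomogeneous.mul
    · rw [← map_intCast (C : ℤ →+* MvPolynomial (Fin p) ℤ)]
      exact isHomogeneous_C _ _
    · apply IsHomogeneous.prod
      intro i _
      exact isHomogeneous_X_pow _ _
  · induction M using Multiset.induction_on with
    | empty => simpa using isHomogeneous_one _ _
    | cons a s ih =>
      simp only [Multiset.map_cons, Multiset.prod_cons, Multiset.sum_cons]
      apply IsHomogeneous.mul _ ih
      apply IsHomogeneous.sum
      intro i _
      exact isHomogeneous_X_pow _ _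

lemma aux_coeff_deg (p : ℕ) (M : Multiset ℕ) (γ : Fin p → ℕ)
    (h : coeff (auxE γ) (auxA p M) ≠ 0) :
    ∑ i, γ i = ∑ i : Fin p, (i.rev : ℕ) + M.sum := by
  have := aux_A_hom p M h
  rw [← this, Finsupp.weight_apply, Finsupp.sum_fintype _ _ (by simp)]
  simp [auxE_apply]

lemma aux_coeff_pow (p m : ℕ) (ε : Fin p →₀ ℕ) (h : ∑ i, ε i = m) :
    coeff ε ((powerSumMv p 1) ^ m) = (Nat.multinomial Finset.univ ε : ℤ) := by
  rw [powerSumMv, Finset.sum_pow_eq_sum_piAntidiag, coeff_sum, Finset.sum_eq_single (ε : Fin p → ℕ)]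
  · have : (∏ i : Fin p, ((X i : MvPolynomial (Fin p) ℤ) ^ 1) ^ ε i) = monomial ε 1 := by
      rw [monomial_eq, Finsupp.prod_fintype _ _ (by simp)]
      simp
    rw [this, ← map_natCast (C : ℤ →+* MvPolynomial (Fin p) ℤ), coeff_C_mul]
    simp
  · intro b _ hb
    have : (∏ i : Fin p, ((X i : MvPolynomial (Fin p) ℤ) ^ 1) ^ b i) = monomial (auxE b) 1 := by
      rw [monomial_eq, Finsupp.prod_fintype _ _ (by simp)]
      simp [auxE_apply]
    rw [this, ← map_natCast (C : ℤ →+* MvPolynomial (Fin p) ℤ), coeff_C_mul, coeff_monomial,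
      if_neg, mul_zero]
    rintro rfl
    exact hb rfl
  · intro hn
    exact absurd (Finset.mem_piAntidiag.2 ⟨h, by simp⟩) hn

/-- Sum over exponent vectors. -/
lemma aux_expand (p q m : ℕ) (M : Multiset ℕ) (hm : M.sum + m = p * q) :
    ((coeff (auxE fun i : Fin p => q + (i.rev : ℕ)) (auxA p M * (powerSumMv p 1) ^ m) : ℤ) : ℚ)
      = ∑ γ : Fin p → Fin (q + p), ((coeff (auxE fun i => (γ i : ℕ)) (auxA p M) : ℤ) : ℚ) *
        (m.factorial * ∏ i : Fin p, (((γ i).rev : ℕ).descFactorial i : ℚ) /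
          (((γ i).rev : ℕ).factorial : ℚ)) := by
  classical
  rw [coeff_mul]
  push_cast
  set β : Fin p → ℕ := fun i => q + (i.rev : ℕ) with hβ
  have hβs : ∑ i, β i = p * q + ∑ i : Fin p, (i.rev : ℕ) := by
    simp [hβ, Finset.sum_add_distrib]
  have key : ∀ γ : Fin p → ℕ, (∀ i, γ i ≤ β i) → coeff (auxE γ) (auxA p M) ≠ 0 →
      ((coeff (auxE β - auxE γ) ((powerSumMv p 1) ^ m) : ℤ) : ℚ) =
        m.factorial * ∏ i : Fin p, (1 / ((β i - γ i).factorial : ℚ)) := by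
    intro γ hle hne
    have hd := aux_coeff_deg p M γ hne
    have hs : ∑ i, (auxE β - auxE γ) i = m := by
      have h1 : ∑ i, (auxE β - auxE γ) i + ∑ i, γ i = ∑ i, β i := by
        rw [← Finset.sum_add_distrib]
        apply Finset.sum_congr rfl
        intro i _
        have := hle i
        simp only [Finsupp.tsub_apply, auxE_apply]
        omega
      omega
    rw [aux_coeff_pow p m _ hs]
    have := Nat.multinomial_spec Finset.univ (auxE β - auxE γ : Fin p →₀ ℕ)
    rw [hs] at this
    rw [← this, Nat.cast_mul, Nat.cast_prod, Int.cast_natCast]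
    have hprod : (∏ i : Fin p, (((auxE β - auxE γ) i).factorial : ℚ)) ≠ 0 := by
      apply Finset.prod_ne_zero_iff.2
      intro i _
      exact_mod_cast Nat.factorial_ne_zero _
    simp only [one_div, Finset.prod_inv_distrib]
    have e : (∏ i : Fin p, ((β i - γ i).factorial : ℚ)) =
      ∏ i : Fin p, (((auxE β - auxE γ) i).factorial : ℚ) := by
      simp [auxE_apply]
    rw [e, mul_comm (∏ i : Fin p, (((auxE β - auxE γ) i).factorial : ℚ)), mul_assoc,
      mul_inv_cancel₀ hprod, mul_one]
  symm
  rw [← Finset.sum_filter_add_sum_filter_not Finset.univ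
    (fun γ : Fin p → Fin (q+p) => ∀ i, (γ i : ℕ) ≤ β i)]
  rw [add_eq_left.2]
  · refine Finset.sum_bij'
      (fun γ _ => ((auxE fun i => (γ i : ℕ)), auxE β - (auxE fun i => (γ i : ℕ))))
      (fun x _ => fun i => ⟨min (x.1 i) (β i), ?_⟩) ?_ ?_ ?_ ?_ ?_
    · have h2 := i.rev.isLt
      have h1 : β i = q + (i.rev : ℕ) := rfl
      omega
    · intro γ hγ
      simp only [Finset.mem_filter, Finset.mem_univ, true_and] at hγ
      rw [Finset.HasAntidiagonal.mem_antidiagonal]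
      exact add_tsub_cancel_of_le (fun i => hγ i)
    · intro x hx
      simp
    · intro γ hγ
      simp only [Finset.mem_filter, Finset.mem_univ, true_and] at hγ
      ext i
      have := hγ i
      simpa [auxE_apply] using this
    · rintro ⟨a, b⟩ hx
      rw [Finset.HasAntidiagonal.mem_antidiagonal] at hx
      simp only at hx
      have hle : ∀ i, a i ≤ β i := by
        intro i
        have := DFunLike.congr_fun hx i
        simp only [Finsupp.add_apply, auxE_apply] at this
        omega
      have h1 : (auxE fun i => min (a i) (β i)) = a := by
        ext i
        simpa [auxE_apply] using hle i
      simp only [h1, Prod.mk.injEq, true_and]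
      rw [← hx]
      simp
    · intro γ hγ
      simp only [Finset.mem_filter, Finset.mem_univ, true_and] at hγ
      by_cases h0 : coeff (auxE fun i => (γ i : ℕ)) (auxA p M) = 0
      · simp [h0]
      · rw [key _ hγ h0]
        congr 2
        apply Finset.prod_congr rfl
        intro i _
        have h1 := hγ i
        have h2 : β i = q + (i.rev : ℕ) := rfl
        rw [Fin.val_rev] at h2
        have h3 := i.isLt
        have hle : (i : ℕ) ≤ ((γ i).rev : ℕ) := by rw [Fin.val_rev]; omega
        have h4 : ((γ i).rev : ℕ) - i = β i - γ i := by rw [Fin.val_rev]; omega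
        have := Nat.factorial_mul_descFactorial hle
        rw [h4] at this
        rw [← this]
        push_cast
        have a1 : ((β i - (γ i : ℕ)).factorial : ℚ) ≠ 0 := by
          exact_mod_cast Nat.factorial_ne_zero _
        have a2 : (((γ i).rev : ℕ).descFactorial i : ℚ) ≠ 0 := by
          have : ((γ i).rev : ℕ).descFactorial i ≠ 0 := by
            rw [Ne, Nat.descFactorial_eq_zero_iff_lt]; omega
          exact_mod_cast this
        field_simp
  · apply Finset.sum_eq_zero
    intro γ hγ
    simp only [Finset.mem_filter, Finset.mem_univ, true_and, not_forall] at hγ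
    obtain ⟨i, hi⟩ := hγ
    have h2 : β i = q + (i.rev : ℕ) := rfl
    rw [Fin.val_rev] at h2
    have : ((γ i).rev : ℕ).descFactorial i = 0 := by
      rw [Nat.descFactorial_eq_zero_iff_lt, Fin.val_rev]; omega
    rw [Finset.prod_eq_zero (Finset.mem_univ i) (by rw [this]; simp)]
    simp

/-- The shifted exponents `λ + δ`. -/
def auxAlpha {p q : ℕ} (f : Fin p → Fin (q + 1)) (i : Fin p) : Fin (q + p) :=
  ⟨(f i : ℕ) + (i.rev : ℕ), by have := (f i).isLt; have := i.rev.isLt; omega⟩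

lemma auxAlpha_strict {p q : ℕ} (f : Fin p → Fin (q + 1)) (hf : Antitone fun i => (f i : ℕ)) :
    StrictAnti (auxAlpha f) := by
  intro i j hij
  have := hf hij.le
  have h2 : (j.rev : ℕ) < (i.rev : ℕ) := Fin.rev_lt_rev.2 hij
  simp only at this
  rw [Fin.lt_def]
  simp only [auxAlpha]
  omega

lemma aux_strict_gap {p N : ℕ} (α : Fin p → Fin N) (h : StrictAnti α) (d : ℕ) :
    ∀ i j : Fin p, (j : ℕ) = i + d → (α j : ℕ) + d ≤ α i := by
  induction d with
  | zero =>
    intro i j hij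
    have : i = j := Fin.ext (by omega)
    simp [this]
  | succ d ih =>
    intro i j hij
    have hj := j.isLt
    have h1 := ih i ⟨i + d, by omega⟩ rfl
    have h2 : α j < α ⟨i + d, by omega⟩ := h (by rw [Fin.lt_def]; simp only; omega)
    rw [Fin.lt_def] at h2
    omega

open scoped Classical in
lemma aux_reorg (p q : ℕ) (G : (Fin p → Fin (q + p)) → ℚ)
    (hG : ∀ γ, ¬ Function.Injective γ → G γ = 0) :
    ∑ γ, G γ = ∑ f ∈ Finset.univ.filter
        (fun f : Fin p → Fin (q + 1) => Antitone fun i => (f i : ℕ)),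
      ∑ w : Equiv.Perm (Fin p), G (auxAlpha f ∘ w) := by
  rw [← Finset.sum_filter_of_ne (p := fun γ => Function.Injective γ)
    (fun γ _ h => by by_contra hn; exact h (hG γ hn))]
  rw [← Finset.sum_product']
  symm
  refine Finset.sum_bij (fun x _ => auxAlpha x.1 ∘ x.2) ?_ ?_ ?_ ?_
  · rintro ⟨f, w⟩ hx
    simp only [Finset.mem_product, Finset.mem_filter, Finset.mem_univ, true_and, and_true] at hx ⊢
    exact (auxAlpha_strict f hx).injective.comp w.injective
  · rintro ⟨f, w⟩ hx ⟨f', w'⟩ hx' he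
    simp only [Finset.mem_product, Finset.mem_filter, Finset.mem_univ, true_and, and_true]
      at hx hx' he
    have s1 := auxAlpha_strict f hx
    have s2 := auxAlpha_strict f' hx'
    have hr : Set.range (auxAlpha f ∘ Fin.rev) = Set.range (auxAlpha f' ∘ Fin.rev) := by
      rw [Fin.rev_surjective.range_comp, Fin.rev_surjective.range_comp,
        ← w.surjective.range_comp, he, w'.surjective.range_comp]
    have hm1 : StrictMono (auxAlpha f ∘ Fin.rev) := s1.comp Fin.rev_strictAnti
    have hm2 : StrictMono (auxAlpha f' ∘ Fin.rev) := s2.comp Fin.rev_strictAnti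
    have e0 := (StrictMono.range_inj hm1 hm2).1 hr
    have e1 : f = f' := by
      funext i
      have := congrFun e0 i.rev
      simp only [Function.comp_apply, Fin.rev_rev, auxAlpha, Fin.mk.injEq] at this
      exact Fin.ext (by omega)
    subst e1
    have e2 : w = w' := by
      ext i
      have := s1.injective (congrFun he i)
      rw [this]
    rw [e2]
  · intro γ hγ
    simp only [Finset.mem_filter, Finset.mem_univ, true_and] at hγ
    set σ : Equiv.Perm (Fin p) := Fin.revPerm.trans (Tuple.sort γ) with hσ
    have hα : StrictAnti (γ ∘ σ) := by
      have h1 := Tuple.monotone_sort γ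
      have h2 : StrictMono (γ ∘ Tuple.sort γ) :=
        h1.strictMono_of_injective (hγ.comp (Tuple.sort γ).injective)
      have h3 := h2.comp_strictAnti (Fin.rev_strictAnti (n := p))
      exact h3
    have hgap := aux_strict_gap (γ ∘ σ) hα
    have hlow : ∀ i : Fin p, (i.rev : ℕ) ≤ (γ ∘ σ) i := by
      intro i
      have hi := i.isLt
      have := hgap (p - 1 - i) i ⟨p - 1, by omega⟩ (by simp only; omega)
      rw [Fin.val_rev]
      omega
    have hhigh : ∀ i : Fin p, ((γ ∘ σ) i : ℕ) - (i.rev : ℕ) < q + 1 := by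
      intro i
      have hi := i.isLt
      have := hgap i ⟨0, by omega⟩ i (by simp)
      have h2 := ((γ ∘ σ) ⟨0, by omega⟩).isLt
      rw [Fin.val_rev]
      omega
    refine ⟨(fun i => ⟨((γ ∘ σ) i : ℕ) - (i.rev : ℕ), hhigh i⟩, σ⁻¹), ?_, ?_⟩
    · simp only [Finset.mem_product, Finset.mem_filter, Finset.mem_univ, true_and, and_true]
      intro i j hij
      have hij' : (i : ℕ) ≤ j := hij
      have hj := j.isLt
      have := hgap (j - i) i j (by omega)
      simp only [Fin.val_rev]
      omega
    · funext i
      apply Fin.ext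
      have := hlow (σ⁻¹ i)
      simp only [Function.comp_apply, auxAlpha] at this ⊢
      rw [Nat.sub_add_cancel this]
      simp
  · rintro ⟨f, w⟩ hx
    rfl

lemma aux_det (p : ℕ) (l : Fin p → ℕ) :
    ∑ w : Equiv.Perm (Fin p), ((Equiv.Perm.sign w : ℤ) : ℚ) *
      ∏ i, ((l (w i)).descFactorial i : ℚ) = ∏ i : Fin p, ∏ j ∈ Finset.Ioi i, ((l j : ℚ) - l i) := by
  have h := Matrix.det_eval_matrixOfPolynomials_eq_det_vandermonde (fun i => (l i : ℚ))
    (fun i : Fin p => descPochhammer ℚ i) (fun i => descPochhammer_natDegree ℚ i)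
    (fun i => monic_descPochhammer ℚ i)
  rw [Matrix.det_vandermonde] at h
  rw [h, Matrix.det_apply']
  simp [descPochhammer_eval_eq_descFactorial]

lemma aux_prod_range {p : ℕ} (g : ℕ → ℕ → ℚ) :
    ∏ i ∈ Finset.range p, ∏ s ∈ Finset.Ioo i p, g i s =
      ∏ i : Fin p, ∏ j ∈ Finset.Ioi i, g j.rev i.rev := by
  rw [Finset.prod_sigma', Finset.prod_sigma']
  refine Finset.prod_bij' (fun x hx => ⟨⟨p - 1 - x.2, ?_⟩, ⟨p - 1 - x.1, ?_⟩⟩)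
    (fun y _ => ⟨p - 1 - y.2, p - 1 - y.1⟩) ?_ ?_ ?_ ?_ ?_
  · simp at hx; omega
  · simp at hx; omega
  · rintro ⟨a, b⟩ hx
    simp only [Finset.mem_sigma, Finset.mem_range, Finset.mem_Ioo, Finset.mem_univ,
      Finset.mem_Ioi, Fin.lt_def, true_and] at hx ⊢
    omega
  · rintro ⟨a, b⟩ hx
    simp only [Finset.mem_sigma, Finset.mem_range, Finset.mem_Ioo, Finset.mem_univ,
      Finset.mem_Ioi, Fin.lt_def, true_and] at hx ⊢
    omega
  · rintro ⟨a, b⟩ hx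
    simp only [Finset.mem_sigma, Finset.mem_range, Finset.mem_Ioo] at hx
    simp only [Sigma.mk.injEq, heq_eq_eq]
    omega
  · rintro ⟨a, b⟩ hx
    simp only [Finset.mem_sigma, Finset.mem_univ,
      Finset.mem_Ioi, Fin.lt_def, true_and] at hx
    simp only [Sigma.mk.injEq, heq_eq_eq, Fin.ext_iff]
    omega
  · rintro ⟨a, b⟩ hx
    simp only [Finset.mem_sigma, Finset.mem_range, Finset.mem_Ioo] at hx
    simp only [Fin.val_rev]
    congr 1 <;> omega

lemma aux_getD {p : ℕ} (ν : Fin p → ℕ) (i : ℕ) (hi : i < p) :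
    (List.ofFn ν).getD i 0 = ν ⟨i, hi⟩ := by
  rw [List.getD_eq_getElem _ _ (by simpa using hi)]
  simp

/-- The hook formula for the complementary shape. -/
lemma aux_hook_compl (p q : ℕ) (f : Fin p → Fin (q + 1)) (hf : Antitone fun i => (f i : ℕ)) :
    hookProd (List.ofFn fun i : Fin p => q - (f i.rev : ℕ)) *
      (∏ i : Fin p, ∏ j ∈ Finset.Ioi i,
        ((((auxAlpha f j).rev : ℕ) : ℚ) - ((auxAlpha f i).rev : ℕ)))
      = ∏ i : Fin p, (((auxAlpha f i).rev : ℕ).factorial : ℚ) := by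
  set L := List.ofFn fun i : Fin p => q - (f i.rev : ℕ) with hLdef
  have hlen : L.length = p := by simp [hLdef]
  have hget : ∀ i : Fin p, L.getD i 0 = q - (f i.rev : ℕ) := by
    intro i; rw [hLdef, aux_getD _ _ i.isLt]
  have hL : ∀ i j, i ≤ j → L.getD j 0 ≤ L.getD i 0 := by
    intro i j hij
    by_cases hj : j < p
    · have h1 := hget ⟨i, by omega⟩
      have h2 := hget ⟨j, hj⟩
      simp only at h1 h2
      rw [h1, h2]
      have h3 : (⟨j, hj⟩ : Fin p).rev ≤ (⟨i, by omega⟩ : Fin p).rev :=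
        Fin.rev_le_rev.2 (by rw [Fin.le_def]; exact hij)
      have := hf h3
      simp only at this
      omega
    · rw [List.getD_eq_default _ _ (by omega)]; omega
  have h := aux_hook L hL
  rw [hlen, aux_prod_range] at h
  have hl : ∀ i : Fin p, ((auxAlpha f i).rev : ℕ) = (q - (f i : ℕ)) + i := by
    intro i
    have := (f i).isLt
    have := i.isLt
    rw [Fin.val_rev]; simp only [auxAlpha, Fin.val_rev]; omega
  have e1 : (∏ i : Fin p, ∏ j ∈ Finset.Ioi i,
        ((((auxAlpha f j).rev : ℕ) : ℚ) - ((auxAlpha f i).rev : ℕ))) =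
      ∏ i : Fin p, ∏ j ∈ Finset.Ioi i, ((L.getD (j.rev : ℕ) 0 : ℚ) - ((j.rev : ℕ) : ℚ)
        - L.getD (i.rev : ℕ) 0 + ((i.rev : ℕ) : ℚ)) := by
    apply Finset.prod_congr rfl
    intro i _
    apply Finset.prod_congr rfl
    intro j _
    rw [hl, hl, hget, hget, Fin.rev_rev, Fin.rev_rev]
    have h1 : ((j.rev : ℕ) : ℚ) = (p : ℚ) - 1 - j := by
      have : (j.rev : ℕ) + j + 1 = p := by rw [Fin.val_rev]; omega
      have h' : ((j.rev : ℕ) : ℚ) + ((j : ℕ) : ℚ) + 1 = (p : ℚ) := by exact_mod_cast this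
      linarith
    have h2 : ((i.rev : ℕ) : ℚ) = (p : ℚ) - 1 - i := by
      have : (i.rev : ℕ) + i + 1 = p := by rw [Fin.val_rev]; omega
      have h' : ((i.rev : ℕ) : ℚ) + ((i : ℕ) : ℚ) + 1 = (p : ℚ) := by exact_mod_cast this
      linarith
    rw [h1, h2]; push_cast; ring
  rw [e1, h, ← Fin.prod_univ_eq_prod_range
    (fun i => ((L.getD i 0 + (p - 1 - i)).factorial : ℚ)),
    ← Equiv.prod_comp Fin.revPerm]
  apply Finset.prod_congr rfl
  intro i _
  rw [hl, Fin.revPerm_apply, hget, Fin.rev_rev, Fin.val_rev]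
  congr 2
  omega

lemma aux_symChar (L : List ℕ) (n : ℕ) (h : L.length = n) (M : Multiset ℕ) :
    symChar L M = coeff (auxE fun i : Fin n => L.getD i 0 + (i.rev : ℕ)) (auxA n M) := by
  subst h
  rw [symChar, auxA, auxE]
  congr 3
  funext i
  rw [Fin.val_rev, List.getD_eq_getElem _ _ i.isLt]
  simp only [List.get_eq_getElem]
  omega

open scoped Classical in
lemma aux_main (p q m : ℕ) (M : Multiset ℕ) (hm : M.sum + m = p * q) :
    (symChar (List.replicate p q) (M + Multiset.replicate m 1) : ℚ) =
      m.factorial * ∑ f ∈ Finset.univ.filter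
              (fun f : Fin p → Fin (q + 1) =>
                (Antitone fun i => (f i : ℕ)) ∧ ∑ i, (f i : ℕ) = M.sum),
            (symChar (List.ofFn fun i => (f i : ℕ)) M : ℚ)
              / hookProd (List.ofFn fun i : Fin p => q - (f i.rev : ℕ)) := by
  have h1 : symChar (List.replicate p q) (M + Multiset.replicate m 1) =
      coeff (auxE fun i : Fin p => q + (i.rev : ℕ)) (auxA p M * (powerSumMv p 1) ^ m) := by
    rw [aux_symChar _ p (by simp), auxA, auxA, Multiset.map_add, Multiset.prod_add,
      Multiset.map_replicate, Multiset.prod_replicate, mul_assoc]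
    congr 2
    funext i
    rw [List.getD_eq_getElem _ _ (by simp)]
    simp
  rw [h1, aux_expand p q m M hm, aux_reorg]
  swap
  · intro γ hγ
    rw [aux_coeff_noninj p M (fun i => (γ i : ℕ))
      (fun hi => hγ (fun a b hab => hi (congrArg Fin.val hab)))]
    simp
  have h2 : ∀ f : Fin p → Fin (q + 1), symChar (List.ofFn fun i => (f i : ℕ)) M =
      coeff (auxE fun i => (auxAlpha f i : ℕ)) (auxA p M) := by
    intro f
    rw [aux_symChar _ p (by simp)]
    congr 2
    funext i
    rw [aux_getD _ _ i.isLt]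
    rfl
  rw [Finset.mul_sum, ← Finset.filter_filter, Finset.sum_filter_of_ne
    (p := fun f : Fin p → Fin (q + 1) => ∑ i, (f i : ℕ) = M.sum)]
  swap
  · intro f _ hne
    have h3 : symChar (List.ofFn fun i => (f i : ℕ)) M ≠ 0 := by
      intro h0; simp [h0] at hne
    rw [h2] at h3
    have := aux_coeff_deg p M _ h3
    simp only [auxAlpha, Finset.sum_add_distrib] at this
    omega
  apply Finset.sum_congr rfl
  intro f hf
  simp only [Finset.mem_filter, Finset.mem_univ, true_and] at hf
  rw [h2]
  have hH := aux_hook_compl p q f hf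
  have hD := aux_det p (fun i => ((auxAlpha f i).rev : ℕ))
  have hfac : (∏ i : Fin p, (((auxAlpha f i).rev : ℕ).factorial : ℚ)) ≠ 0 := by
    apply Finset.prod_ne_zero_iff.2
    intro i _
    exact_mod_cast Nat.factorial_ne_zero _
  have hH0 : hookProd (List.ofFn fun i : Fin p => q - (f i.rev : ℕ)) ≠ 0 := by
    intro h0
    rw [h0, zero_mul] at hH
    exact hfac hH.symm
  have hterm : ∀ w : Equiv.Perm (Fin p),
      ((coeff (auxE fun i => ((auxAlpha f ∘ w) i : ℕ)) (auxA p M) : ℤ) : ℚ) *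
        (m.factorial * ∏ i : Fin p, ((((auxAlpha f ∘ w) i).rev : ℕ).descFactorial i : ℚ) /
          ((((auxAlpha f ∘ w) i).rev : ℕ).factorial : ℚ)) =
      (((coeff (auxE fun i => (auxAlpha f i : ℕ)) (auxA p M) : ℤ) : ℚ) * m.factorial /
        (∏ i : Fin p, (((auxAlpha f i).rev : ℕ).factorial : ℚ))) *
      (((Equiv.Perm.sign w : ℤ) : ℚ) *
        ∏ i, (((auxAlpha f (w i)).rev : ℕ).descFactorial i : ℚ)) := by
    intro w
    have e1 := aux_coeff_perm p M w (fun i => (auxAlpha f i : ℕ))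
    have e2 : (fun i => ((auxAlpha f ∘ w) i : ℕ)) = (fun i => (auxAlpha f i : ℕ)) ∘ w := rfl
    rw [e2, e1, Finset.prod_div_distrib]
    have e3 : ∏ i : Fin p, ((((auxAlpha f ∘ w) i).rev : ℕ).factorial : ℚ) =
        ∏ i : Fin p, (((auxAlpha f i).rev : ℕ).factorial : ℚ) :=
      Equiv.prod_comp w (fun i => (((auxAlpha f i).rev : ℕ).factorial : ℚ))
    rw [e3]
    push_cast
    simp only [Function.comp_apply]
    ring
  rw [Finset.sum_congr rfl (fun w _ => hterm w), ← Finset.mul_sum, hD]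
  rw [div_mul_eq_mul_div, mul_div_assoc', div_eq_div_iff hfac hH0, ← hH]
  ring

lemma aux_hook_rect_ne (p q : ℕ) : hookProd (List.replicate p q) ≠ 0 := by
  have hH := aux_hook_compl p q (fun _ => 0) (fun _ _ _ => le_rfl)
  have e : (List.ofFn fun i : Fin p => q - (((fun _ => 0 : Fin p → Fin (q+1)) i.rev : Fin (q+1)) : ℕ))
      = List.replicate p q := by
    simp
  rw [e] at hH
  intro h0
  rw [h0, zero_mul] at hH
  have hfac : (∏ i : Fin p, (((auxAlpha (fun _ => 0 : Fin p → Fin (q+1)) i).rev : ℕ).factorial : ℚ)) ≠ 0 := by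
    apply Finset.prod_ne_zero_iff.2
    intro i _
    exact_mod_cast Nat.factorial_ne_zero _
  exact hfac hH.symm

lemma aux_vdm_coeff (p : ℕ) : coeff (auxE fun i : Fin p => (i.rev : ℕ)) (vandermondeMv p) = 1 := by
  rw [aux_vdm_det, Matrix.det_apply', coeff_sum, Finset.sum_eq_single 1]
  · have : (∏ i : Fin p, (X i : MvPolynomial (Fin p) ℤ) ^ (i.rev : ℕ)) =
        monomial (auxE fun i : Fin p => (i.rev : ℕ)) 1 := by
      rw [monomial_eq, Finsupp.prod_fintype _ _ (by simp)]
      simp [auxE_apply]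
    simp only [Equiv.Perm.sign_one, Equiv.Perm.one_apply, Matrix.of_apply, this]
    simp
  · intro σ _ hσ
    have : (∏ i : Fin p, (X (σ i) : MvPolynomial (Fin p) ℤ) ^ (i.rev : ℕ)) =
        monomial (auxE fun i : Fin p => ((σ⁻¹ i).rev : ℕ)) 1 := by
      rw [monomial_eq, Finsupp.prod_fintype _ _ (by simp), C_1, one_mul]
      simp only [auxE_apply]
      rw [← Equiv.prod_comp σ (fun i => (X i : MvPolynomial (Fin p) ℤ) ^ ((σ⁻¹ i).rev : ℕ))]
      simp
    simp only [Matrix.of_apply, this]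
    rw [← map_intCast (C : ℤ →+* MvPolynomial (Fin p) ℤ), coeff_C_mul, coeff_monomial,
      if_neg, mul_zero]
    intro h
    apply hσ
    have h3 : σ⁻¹ = 1 := by
      ext i
      have := DFunLike.congr_fun h i
      simp only [auxE_apply] at this
      have := Fin.rev_injective (Fin.ext this)
      rw [this]; rfl
    simpa using h3
  · simp

lemma aux_rect_dim (p q : ℕ) :
    (symChar (List.replicate p q) (Multiset.replicate (p * q) 1) : ℚ) =
      (p * q).factorial / hookProd (List.replicate p q) := by
  have h := aux_main p q (p * q) 0 (by simp)
  rw [zero_add] at h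
  rw [h, Finset.sum_eq_single (fun _ => 0)]
  · have e : (List.ofFn fun i : Fin p => q - (((fun _ => 0 : Fin p → Fin (q+1)) i.rev : Fin (q+1)) : ℕ))
      = List.replicate p q := by
      simp
    rw [e, aux_symChar _ p (by simp)]
    have e2 : (auxE fun i : Fin p => (List.ofFn fun i : Fin p =>
        (((fun _ => 0 : Fin p → Fin (q+1)) i : Fin (q+1)) : ℕ)).getD i 0 + (i.rev : ℕ)) =
        auxE fun i : Fin p => (i.rev : ℕ) := by
      congr 1
      funext i
      rw [aux_getD _ _ i.isLt]
      simp
    rw [e2, auxA]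
    simp only [Multiset.map_zero, Multiset.prod_zero, mul_one, aux_vdm_coeff]
    simp [div_eq_mul_inv]
  · intro f hf hne
    exfalso
    apply hne
    simp only [Finset.mem_filter, Multiset.sum_zero, Finset.sum_eq_zero_iff] at hf
    funext i
    exact Fin.ext (hf.2.2 i (Finset.mem_univ i))
  · intro hn
    exfalso
    apply hn
    simp only [Finset.mem_filter, Finset.mem_univ, true_and]
    exact ⟨fun _ _ _ => le_rfl, by simp⟩

open scoped Classical in
/-- For `p, q ≥ 1` and `μ ⊢ k` with `k ≤ pq`:
`χ̂^{p×q}(μ,1^{pq-k}) = H_{p×q} ∑_{λ ⊆ p×q, λ ⊢ k} χ^λ(μ) / H_{λ̃}`, where a partition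
`λ ⊆ p×q` is encoded as an antitone function `f : Fin p → Fin (q+1)` (its parts, zeros
allowed) and the complement is `λ̃_i = q - λ_{p+1-i}`. -/
theorem normalized_rectangular_character_as_hook_sum
    (p q k : ℕ) (hp : 1 ≤ p) (hq : 1 ≤ q) (hk : k ≤ p * q) (μ : Nat.Partition k) :
    ((p * q).descFactorial k : ℚ)
        * (symChar (List.replicate p q) (μ.parts + Multiset.replicate (p * q - k) 1) : ℚ)
        / (symChar (List.replicate p q) (Multiset.replicate (p * q) 1) : ℚ)
      = hookProd (List.replicate p q) *
          ∑ f ∈ Finset.univ.filter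
              (fun f : Fin p → Fin (q + 1) =>
                (Antitone fun i => (f i : ℕ)) ∧ ∑ i, (f i : ℕ) = k),
            (symChar (List.ofFn fun i => (f i : ℕ)) μ.parts : ℚ)
              / hookProd (List.ofFn fun i : Fin p => q - (f i.rev : ℕ)) := by
  have hsum : μ.parts.sum = k := μ.parts_sum
  have h1 := aux_main p q (p * q - k) μ.parts (by rw [hsum]; omega)
  rw [hsum] at h1
  rw [h1, aux_rect_dim]
  have hH := aux_hook_rect_ne p q
  have hf : ((p * q).factorial : ℚ) ≠ 0 := by exact_mod_cast Nat.factorial_ne_zero _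
  have hd := Nat.factorial_mul_descFactorial hk
  have hd' : ((p * q - k).factorial : ℚ) * ((p * q).descFactorial k : ℚ)
      = ((p * q).factorial : ℚ) := by exact_mod_cast hd
  rw [← mul_assoc, mul_comm ((p * q).descFactorial k : ℚ), hd']
  field_simp
end
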